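/- Let X be a complex Banach space, p > 0, let (I,‖·‖_I) be an l_p-ideal in B(X) with eigenvalue constant γ_p, let Γ_p > 0 satisfy |det_p(I−F)| ≤ exp(Γ_p ∑_j |λ_j(F)|^p) for all finite rank F on X, let A ∈ B(X), K ∈ I, and let D(λ) = det_{p,I}(I − K(λ−A)^{-1}) for λ ∈ ρ(A) be the p-regularized perturbation determinant. Then: (i) D(λ) → 1 as |λ| → ∞; (ii) D is analytic on ρ(A); (iii) |D(λ)| ≤ exp(γ_p^p Γ_p ‖K(λ−A)^{-1}‖_I^p) for all λ ∈ ρ(A). -/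

import Mathlib

open scoped ENNReal

variable {X : Type*} [NormedAddCommGroup X] [NormedSpace ℂ X] [CompleteSpace X]

/-- A continuous linear operator has finite rank. -/
def IsFiniteRank (F : X →L[ℂ] X) : Prop :=
  FiniteDimensional ℂ (LinearMap.range (F : X →ₗ[ℂ] X))

/-- `det(I - F)`, defined as the determinant of the restriction of `I - F` to the
(finite-dimensional) range of `F`. -/
noncomputable def detOneSub (F : X →L[ℂ] X) : ℂ :=
  LinearMap.det
    ((LinearMap.id : LinearMap.range (F : X →ₗ[ℂ] X) →ₗ[ℂ] LinearMap.range (F : X →ₗ[ℂ] X)) -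
      (F : X →ₗ[ℂ] X).restrict fun x _ => LinearMap.mem_range_self _ x)

/-- `tr F`, the trace of the restriction of `F` to its range. -/
noncomputable def trOn (F : X →L[ℂ] X) : ℂ :=
  LinearMap.trace ℂ (LinearMap.range (F : X →ₗ[ℂ] X))
    ((F : X →ₗ[ℂ] X).restrict fun x _ => LinearMap.mem_range_self _ x)

/-- The `p`-regularized determinant `det_p(I-F)` of a finite rank operator. -/
noncomputable def detp (p : ℝ) (F : X →L[ℂ] X) : ℂ :=
  detOneSub F * Complex.exp (∑ k ∈ Finset.Icc 1 (⌈p⌉₊ - 1), trOn (F ^ k) / (k : ℂ))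

open scoped ENNReal

variable {X : Type*} [NormedAddCommGroup X] [NormedSpace ℂ X] [CompleteSpace X]

/-- The Riesz projection of `T` at `μ`, computed with the circle of radius `r` around `μ`. -/
noncomputable def rieszProjection (T : X →L[ℂ] X) (μ : ℂ) (r : ℝ) : X →L[ℂ] X :=
  (2 * Real.pi * Complex.I)⁻¹ • ∮ z in C(μ, r), resolvent T z

/-- `μ` is a discrete eigenvalue of `T`: an isolated point of the spectrum whose
Riesz projection has finite-dimensional range. -/
def IsDiscreteEigenvalue (T : X →L[ℂ] X) (μ : ℂ) : Prop :=
  μ ∈ spectrum ℂ T ∧ ∃ r, 0 < r ∧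
    (∀ z ∈ Metric.closedBall μ r, z ≠ μ → z ∉ spectrum ℂ T) ∧
    FiniteDimensional ℂ (LinearMap.range ((rieszProjection T μ r : X →L[ℂ] X) : X →ₗ[ℂ] X))

open scoped Classical in
/-- The algebraic multiplicity of `μ`: the dimension of the range of the Riesz projection
computed with a radius isolating `μ` from the rest of the spectrum. -/
noncomputable def algebraicMultiplicity (T : X →L[ℂ] X) (μ : ℂ) : ℕ :=
  if h : ∃ r, 0 < r ∧ ∀ z ∈ Metric.closedBall μ r, z ≠ μ → z ∉ spectrum ℂ T then
    Module.finrank ℂ (LinearMap.range ((rieszProjection T μ h.choose : X →L[ℂ] X) : X →ₗ[ℂ] X))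
  else 0

/-- `∑_j |λ_j(T)|^p`, the sum over the discrete eigenvalues of `T`, counted with
algebraic multiplicity (as an extended nonnegative real). -/
noncomputable def eigSum (p : ℝ) (T : X →L[ℂ] X) : ℝ≥0∞ :=
  ∑' μ : {μ : ℂ // IsDiscreteEigenvalue T μ},
    (algebraicMultiplicity T (μ : ℂ) : ℝ≥0∞) * ENNReal.ofReal (‖(μ : ℂ)‖ ^ p)

/-- The number of discrete eigenvalues of `T` in the set `S`, counted with algebraic
multiplicity (as an extended nonnegative real). -/
noncomputable def eigCount (T : X →L[ℂ] X) (S : Set ℂ) : ℝ≥0∞ :=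
  ∑' μ : {μ : ℂ // μ ∈ S ∧ IsDiscreteEigenvalue T μ},
    (algebraicMultiplicity T (μ : ℂ) : ℝ≥0∞)

/-- An `l_p`-ideal in `B(X)`: a quasi-normed subspace (with quasi-norm `norm'` and
quasi-triangle constant `q`) of the bounded operators on `X` in which the finite rank
operators are dense (A1), whose quasi-norm dominates the operator norm (A2), which is a
two-sided ideal with submultiplicative quasi-norm (A3), and whose members have
`l_p`-summable discrete eigenvalue sequences, with eigenvalue constant `γ` (A4). -/
structure LpIdeal (p : ℝ) (X : Type*) [NormedAddCommGroup X] [NormedSpace ℂ X]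
    [CompleteSpace X] where
  carrier : Set (X →L[ℂ] X)
  norm' : (X →L[ℂ] X) → ℝ
  q : ℝ
  γ : ℝ
  one_le_q : 1 ≤ q
  γ_nonneg : 0 ≤ γ
  add_mem : ∀ {K L : X →L[ℂ] X}, K ∈ carrier → L ∈ carrier → K + L ∈ carrier
  smul_mem : ∀ (c : ℂ) {L : X →L[ℂ] X}, L ∈ carrier → c • L ∈ carrier
  norm'_nonneg : ∀ L ∈ carrier, 0 ≤ norm' L
  norm'_eq_zero_iff : ∀ L ∈ carrier, (norm' L = 0 ↔ L = 0)
  norm'_smul : ∀ L ∈ carrier, ∀ c : ℂ, norm' (c • L) = ‖c‖ * norm' L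
  norm'_add_le : ∀ K ∈ carrier, ∀ L ∈ carrier, norm' (K + L) ≤ q * (norm' K + norm' L)
  finiteRank_mem : ∀ F : X →L[ℂ] X, IsFiniteRank F → F ∈ carrier
  dense_finiteRank : ∀ L ∈ carrier, ∀ ε > 0, ∃ F : X →L[ℂ] X, IsFiniteRank F ∧ norm' (L - F) < ε
  opNorm_le : ∀ L ∈ carrier, ‖L‖ ≤ norm' L
  mul_mem : ∀ L ∈ carrier, ∀ A B : X →L[ℂ] X, A * L * B ∈ carrier
  mul_norm'_le : ∀ L ∈ carrier, ∀ A B : X →L[ℂ] X, norm' (A * L * B) ≤ ‖A‖ * norm' L * ‖B‖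
  eig_le : ∀ L ∈ carrier, eigSum p L ≤ ENNReal.ofReal ((γ * norm' L) ^ p)

/-- `D` is continuous on the ideal `I` with respect to the quasi-norm of `I`. -/
def IdealContinuous {p : ℝ} (I : LpIdeal p X) (D : (X →L[ℂ] X) → ℂ) : Prop :=
  ∀ L ∈ I.carrier, ∀ ε > 0, ∃ δ > 0, ∀ K ∈ I.carrier, I.norm' (K - L) < δ → ‖D K - D L‖ < ε

/-- `D` agrees with the `p`-regularized determinant on the finite rank operators. -/
def ExtendsDetp (p : ℝ) (D : (X →L[ℂ] X) → ℂ) : Prop :=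
  ∀ F : X →L[ℂ] X, IsFiniteRank F → D F = detp p F

section LinearAlgebra

variable {V : Type*} [AddCommGroup V] [Module ℂ V] [FiniteDimensional ℂ V]

/-- The determinant of `1 - z M` is the product of `1 - z λ` over the eigenvalues of `M`. -/
lemma det_one_sub_smul_eq_prod_roots (M : Module.End ℂ V) (z : ℂ) :
    LinearMap.det (1 - z • M) = (M.charpoly.roots.map fun l => 1 - z * l).prod := by
  have hs : M.charpoly.Splits := IsAlgClosed.splits _
  have hcard : M.charpoly.roots.card = Module.finrank ℂ V := by
    rw [← hs.natDegree_eq_card_roots, LinearMap.charpoly_natDegree]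
  rcases eq_or_ne z 0 with rfl | hz
  · simp
  have h1 : (1 - z • M : Module.End ℂ V) = z • (algebraMap ℂ (Module.End ℂ V) z⁻¹ - M) := by
    rw [smul_sub, Algebra.algebraMap_eq_smul_one, smul_smul, mul_inv_cancel₀ hz, one_smul]
  have h2 : (M.charpoly.roots.map fun l => 1 - z * l) =
      M.charpoly.roots.map fun l => z * (z⁻¹ - l) := by
    congr 1; ext l; field_simp
  rw [h1, LinearMap.det_smul, ← LinearMap.eval_charpoly, h2, Multiset.prod_map_mul, Multiset.map_const',
    Multiset.prod_replicate, hcard, hs.eval_eq_prod_roots_of_monic M.charpoly_monic]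

/-- The trace of `M ^ k` is the sum of the `k`-th powers of the eigenvalues of `M`. -/
lemma trace_pow_eq_sum_roots (M : Module.End ℂ V) (k : ℕ) :
    LinearMap.trace ℂ V (M ^ k) = (M.charpoly.roots.map fun l => l ^ k).sum := by
  classical
  have hmaps : ∀ μ, Set.MapsTo (M ^ k) (M.maxGenEigenspace μ) (M.maxGenEigenspace μ) := fun μ =>
    M.mapsTo_maxGenEigenspace_of_comm (Commute.pow_right rfl k) μ
  have hds := DirectSum.isInternal_submodule_of_iSupIndep_of_iSup_eq_top
    M.independent_maxGenEigenspace (Module.End.iSup_maxGenEigenspace_eq_top M)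
  have hfin : {μ | M.maxGenEigenspace μ ≠ ⊥}.Finite :=
    WellFoundedGT.finite_ne_bot_of_iSupIndep M.independent_maxGenEigenspace
  have htr : ∀ μ, LinearMap.trace ℂ (M.maxGenEigenspace μ) ((M ^ k).restrict (hmaps μ)) =
      (M.charpoly.rootMultiplicity μ : ℂ) * μ ^ k := by
    intro μ
    have hM := M.mapsTo_maxGenEigenspace_of_comm (Commute.refl M) μ
    set N : Module.End ℂ (M.maxGenEigenspace μ) := M.restrict hM
    have hpow : (M ^ k).restrict (hmaps μ) = N ^ k := (Module.End.pow_restrict k hM _).symm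
    have hnil : IsNilpotent (N - algebraMap ℂ _ μ) := by
      have := M.isNilpotent_restrict_maxGenEigenspace_sub_algebraMap μ
      convert this using 1
      ext v; simp [N, LinearMap.sub_apply, Algebra.algebraMap_eq_smul_one]; rfl
    have hnil' : IsNilpotent (N ^ k - algebraMap ℂ _ μ ^ k) := by
      obtain ⟨c, hc⟩ := Commute.sub_dvd_pow_sub_pow ((Algebra.commutes μ N).symm :
        Commute N (algebraMap ℂ (Module.End ℂ (M.maxGenEigenspace μ)) μ)) k
      have hcomm : Commute (N - algebraMap ℂ _ μ)
          (∑ i ∈ Finset.range k, N ^ i *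
            (algebraMap ℂ (Module.End ℂ (M.maxGenEigenspace μ)) μ) ^ (k - 1 - i)) := by
        apply Commute.sum_right
        intro i _
        have h1 : Commute (N - algebraMap ℂ (Module.End ℂ (M.maxGenEigenspace μ)) μ) N :=
          (Commute.refl N).sub_left (Algebra.commutes μ N)
        exact (h1.pow_right i).mul_right (Commute.pow_right (Algebra.commutes μ _).symm _)
      rw [← Commute.mul_geom_sum₂ ((Algebra.commutes μ N).symm)]
      exact hcomm.isNilpotent_mul_right hnil
    have h0 := (LinearMap.isNilpotent_trace_of_isNilpotent hnil').eq_zero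
    rw [map_sub, sub_eq_zero, ← map_pow, Algebra.algebraMap_eq_smul_one, map_smul,
      LinearMap.trace_one, M.finrank_maxGenEigenspace_eq] at h0
    rw [hpow, h0, smul_eq_mul, mul_comm]
  rw [LinearMap.trace_eq_sum_trace_restrict' hds hfin hmaps, Finset.sum_multiset_map_count]
  simp_rw [htr, Polynomial.count_roots, nsmul_eq_mul]
  symm
  apply Finset.sum_subset
  · intro μ hμ
    rw [Multiset.mem_toFinset, ← Multiset.count_pos, Polynomial.count_roots,
      ← M.finrank_maxGenEigenspace_eq] at hμ
    rw [Set.Finite.mem_toFinset, Set.mem_ofPred_eq]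
    intro h
    rw [h] at hμ
    simp at hμ
  · intro μ _ hμ
    rw [Multiset.mem_toFinset, ← Multiset.count_eq_zero, Polynomial.count_roots] at hμ
    simp [hμ]

/-- `det (A + w f ⊗ x)` is affine in `w`. -/
lemma det_add_smul_smulRight (A : Module.End ℂ V) (f : V →ₗ[ℂ] ℂ) (x : V) (w : ℂ) :
    LinearMap.det (A + w • f.smulRight x) =
      (1 - w) * LinearMap.det A + w * LinearMap.det (A + f.smulRight x) := by
  classical
  let b := Module.finBasis ℂ V
  have hinv : ∀ A : Matrix (Fin (Module.finrank ℂ V)) (Fin (Module.finrank ℂ V)) ℂ,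
      ∀ u v : Fin (Module.finrank ℂ V) → ℂ, IsUnit A.det → ∀ w : ℂ,
      (A + w • Matrix.vecMulVec u v).det =
        A.det * (1 + w * (Matrix.replicateRow Unit v * A⁻¹ * Matrix.replicateCol Unit u) () ()) := by
    intro A u v hA w
    have := Matrix.det_add_replicateCol_mul_replicateRow (ι := Unit) hA (w • u) v
    rw [← Matrix.vecMulVec_eq, Matrix.smul_vecMulVec] at this
    rw [this, Matrix.det_unique (n := Unit)]
    simp [Matrix.mul_apply, Finset.mul_sum]
  have hgen : ∀ A : Matrix (Fin (Module.finrank ℂ V)) (Fin (Module.finrank ℂ V)) ℂ,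
      ∀ u v : Fin (Module.finrank ℂ V) → ℂ, ∀ w : ℂ,
      (A + w • Matrix.vecMulVec u v).det =
        (1 - w) * A.det + w * (A + Matrix.vecMulVec u v).det := by
    intro A u v w
    let p : ℂ → ℂ := fun t => (t • 1 + A + w • Matrix.vecMulVec u v).det
    let q : ℂ → ℂ := fun t => (1 - w) * (t • 1 + A).det + w * (t • 1 + A + Matrix.vecMulVec u v).det
    have hpq : p =ᶠ[nhdsWithin 0 {0}ᶜ] q := by
      have hfin : ((-A).charpoly.roots.toFinset : Set ℂ).Finite := Finset.finite_toSet _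
      have h1 : ∀ᶠ t in nhdsWithin (0 : ℂ) {0}ᶜ, t ∉ ((-A).charpoly.roots.toFinset : Set ℂ) :=
        (hfin.subset Set.sdiff_subset).isClosed.isOpen_compl.eventually_mem
          (fun h : (0 : ℂ) ∈ _ \ {0} => h.2 rfl) |>.filter_mono nhdsWithin_le_nhds |>.and
          self_mem_nhdsWithin |>.mono fun t ht h => ht.1 ⟨h, ht.2⟩
      filter_upwards [h1] with t ht
      have hu : IsUnit (t • 1 + A).det := by
        rw [isUnit_iff_ne_zero]
        intro h0
        apply ht
        simp only [Finset.mem_coe, Multiset.mem_toFinset]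
        rw [Polynomial.mem_roots (Matrix.charpoly_monic _).ne_zero, Polynomial.IsRoot,
          Matrix.eval_charpoly, sub_neg_eq_add, Matrix.scalar_apply,
          ← Matrix.smul_one_eq_diagonal, h0]
      have h2 := hinv _ u v hu 1
      rw [one_smul] at h2
      simp only [p, q]
      rw [hinv _ u v hu, h2]; ring
    have hp : Continuous p := by fun_prop
    have hq : Continuous q := by fun_prop
    have h0 := tendsto_nhds_unique_of_eventuallyEq
      (hp.tendsto 0 |>.mono_left nhdsWithin_le_nhds) (hq.tendsto 0 |>.mono_left nhdsWithin_le_nhds) hpq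
    simpa [p, q] using h0
  have hmat : LinearMap.toMatrix b b (f.smulRight x) =
      Matrix.vecMulVec (b.repr x) (fun j => f (b j)) := by
    ext i j; simp [LinearMap.toMatrix_apply, Matrix.vecMulVec_apply, mul_comm]
  simp only [← LinearMap.det_toMatrix b, map_add, map_smul, hmat]
  exact hgen _ _ _ _

/-- Scaling a sum of rank one perturbations increases the determinant at most polynomially. -/
lemma norm_det_sub_smul_sum_le {ι : Type*} [DecidableEq ι] (s : Finset ι)
    (f : ι → V →ₗ[ℂ] ℂ) (x : ι → V) (w : ℂ) (B : ℝ) (A : Module.End ℂ V)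
    (hB : ∀ S ⊆ s, ‖LinearMap.det (A - ∑ i ∈ S, (f i).smulRight (x i))‖ ≤ B) :
    ‖LinearMap.det (A - w • ∑ i ∈ s, (f i).smulRight (x i))‖ ≤ (1 + 2 * ‖w‖) ^ s.card * B := by
  induction s using Finset.induction_on generalizing A B with
  | empty => simpa using hB ∅ (by simp)
  | insert a s ha ih =>
    rw [Finset.sum_insert ha, smul_add, ← sub_sub, Finset.card_insert_of_notMem ha, pow_succ,
      mul_assoc]
    apply ih
    intro S hS
    have haS : a ∉ S := fun h => ha (hS h)
    have h0 := hB S (hS.trans (Finset.subset_insert _ _))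
    have h1 := hB (insert a S) (Finset.insert_subset_insert _ hS)
    rw [Finset.sum_insert haS] at h1
    have key := det_add_smul_smulRight (A - ∑ i ∈ S, (f i).smulRight (x i)) (f a) (-x a) w
    have e1 : ((f a).smulRight (-x a) : V →ₗ[ℂ] V) = -(f a).smulRight (x a) := by ext; simp
    rw [e1] at key
    have e2 : A - w • (f a).smulRight (x a) - ∑ i ∈ S, (f i).smulRight (x i) =
        A - ∑ i ∈ S, (f i).smulRight (x i) + w • -(f a).smulRight (x a) := by
      rw [smul_neg]; abel
    have e3 : A - ((f a).smulRight (x a) + ∑ i ∈ S, (f i).smulRight (x i)) =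
        A - ∑ i ∈ S, (f i).smulRight (x i) + -(f a).smulRight (x a) := by abel
    rw [e3] at h1
    rw [e2, key]
    calc _ ≤ ‖1 - w‖ * _ + ‖w‖ * _ := by
            refine (norm_add_le _ _).trans ?_; rw [norm_mul, norm_mul]
      _ ≤ (1 + ‖w‖) * B + ‖w‖ * B := by
            have : ‖1 - w‖ ≤ 1 + ‖w‖ := by simpa using norm_sub_le 1 w
            gcongr
      _ = _ := by ring

end LinearAlgebra

section FiniteRank

omit [CompleteSpace X]

/-- The endomorphism of `V` induced by an operator whose range lies in `V`. -/
noncomputable def restrictTo (V : Submodule ℂ X) (F : X →L[ℂ] X) (h : ∀ x, F x ∈ V) :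
    Module.End ℂ V :=
  (F : X →ₗ[ℂ] X).restrict fun x _ => h x

@[simp] lemma coe_restrictTo_apply (V : Submodule ℂ X) (F : X →L[ℂ] X) (h : ∀ x, F x ∈ V) (v : V) :
    (restrictTo V F h v : X) = F v := rfl

lemma restrictTo_smul (V : Submodule ℂ X) (F : X →L[ℂ] X) (h : ∀ x, F x ∈ V) (z : ℂ)
    (h' : ∀ x, (z • F) x ∈ V) : restrictTo V (z • F) h' = z • restrictTo V F h := rfl

lemma restrictTo_add (V : Submodule ℂ X) (F G : X →L[ℂ] X) (hF : ∀ x, F x ∈ V)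
    (hG : ∀ x, G x ∈ V) (h : ∀ x, (F + G) x ∈ V) :
    restrictTo V (F + G) h = restrictTo V F hF + restrictTo V G hG := rfl

lemma restrictTo_pow (V : Submodule ℂ X) (F : X →L[ℂ] X) (h : ∀ x, F x ∈ V) (k : ℕ)
    (h' : ∀ x, (F ^ k) x ∈ V) : restrictTo V (F ^ k) h' = restrictTo V F h ^ k := by
  have key : ∀ (k : ℕ) (v : V), ((restrictTo V F h ^ k) v : X) = (F ^ k) v := by
    intro k
    induction k with
    | zero => intro v; simp
    | succ k ih => intro v; rw [pow_succ, pow_succ, Module.End.mul_apply, ih]; rfl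
  ext v
  rw [key]; rfl

lemma pow_apply_mem (V : Submodule ℂ X) {F : X →L[ℂ] X} (h : ∀ x, F x ∈ V) {k : ℕ} (hk : 1 ≤ k)
    (x : X) : (F ^ k) x ∈ V := by
  obtain ⟨j, rfl⟩ := Nat.exists_eq_add_of_le' hk
  rw [pow_succ']
  exact h _

lemma range_le_of_forall_mem {V : Submodule ℂ X} {F : X →L[ℂ] X} (h : ∀ x, F x ∈ V) :
    LinearMap.range (F : X →ₗ[ℂ] X) ≤ V := by
  rintro _ ⟨x, rfl⟩; exact h x

lemma isFiniteRank_of_forall_mem (V : Submodule ℂ X) [FiniteDimensional ℂ V] {F : X →L[ℂ] X}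
    (h : ∀ x, F x ∈ V) : IsFiniteRank F :=
  Submodule.finiteDimensional_of_le (range_le_of_forall_mem h)

lemma detOneSub_eq_det (V : Submodule ℂ X) [FiniteDimensional ℂ V] (F : X →L[ℂ] X)
    (h : ∀ x, F x ∈ V) : detOneSub F = LinearMap.det (1 - restrictTo V F h) := by
  have : FiniteDimensional ℂ (LinearMap.range (F : X →ₗ[ℂ] X)) := isFiniteRank_of_forall_mem V h
  let g : V →ₗ[ℂ] LinearMap.range (F : X →ₗ[ℂ] X) := (F : X →ₗ[ℂ] X).rangeRestrict ∘ₗ V.subtype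
  let i : LinearMap.range (F : X →ₗ[ℂ] X) →ₗ[ℂ] V := Submodule.inclusion (range_le_of_forall_mem h)
  have h1 : restrictTo V F h = i ∘ₗ g := rfl
  have h2 : ((F : X →ₗ[ℂ] X).restrict fun x _ => LinearMap.mem_range_self _ x :
      LinearMap.range (F : X →ₗ[ℂ] X) →ₗ[ℂ] LinearMap.range (F : X →ₗ[ℂ] X)) = g ∘ₗ i := rfl
  rw [detOneSub, h1, h2]
  let b := Module.finBasis ℂ V
  let c := Module.finBasis ℂ (LinearMap.range (F : X →ₗ[ℂ] X))
  rw [← LinearMap.det_toMatrix b, ← LinearMap.det_toMatrix c, map_sub, map_sub,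
    LinearMap.toMatrix_one, LinearMap.toMatrix_id,
    LinearMap.toMatrix_comp b c b, LinearMap.toMatrix_comp c b c, Matrix.det_one_sub_mul_comm]

lemma trOn_eq_trace (V : Submodule ℂ X) [FiniteDimensional ℂ V] (F : X →L[ℂ] X)
    (h : ∀ x, F x ∈ V) : trOn F = LinearMap.trace ℂ V (restrictTo V F h) := by
  have : FiniteDimensional ℂ (LinearMap.range (F : X →ₗ[ℂ] X)) := isFiniteRank_of_forall_mem V h
  let g : V →ₗ[ℂ] LinearMap.range (F : X →ₗ[ℂ] X) := (F : X →ₗ[ℂ] X).rangeRestrict ∘ₗ V.subtype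
  let i : LinearMap.range (F : X →ₗ[ℂ] X) →ₗ[ℂ] V := Submodule.inclusion (range_le_of_forall_mem h)
  exact (LinearMap.trace_comp_comm' g i).symm

/-- The regularized determinant computed on any finite-dimensional space containing the range. -/
lemma detp_eq (p : ℝ) (V : Submodule ℂ X) [FiniteDimensional ℂ V] (F : X →L[ℂ] X)
    (h : ∀ x, F x ∈ V) :
    detp p F = LinearMap.det (1 - restrictTo V F h) *
      Complex.exp (∑ k ∈ Finset.Icc 1 (⌈p⌉₊ - 1),
        LinearMap.trace ℂ V (restrictTo V F h ^ k) / (k : ℂ)) := by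
  rw [detp, detOneSub_eq_det V F h]
  congr 2
  refine Finset.sum_congr rfl fun k hk => ?_
  rw [trOn_eq_trace V (F ^ k) (pow_apply_mem V h (Finset.mem_Icc.1 hk).1), restrictTo_pow V F h]

/-- The regularized factor `(1 - u) exp(u + u²/2 + ⋯ + uᵐ/m)`. -/
noncomputable def weierstrassFactor (m : ℕ) (u : ℂ) : ℂ :=
  (1 - u) * Complex.exp (∑ k ∈ Finset.Icc 1 m, u ^ k / (k : ℂ))

/-- The regularized determinant as a product over eigenvalues. -/
lemma detp_smul_eq_prod (p : ℝ) (V : Submodule ℂ X) [FiniteDimensional ℂ V] (F : X →L[ℂ] X)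
    (h : ∀ x, F x ∈ V) (z : ℂ) :
    detp p (z • F) = ((restrictTo V F h).charpoly.roots.map
      fun l => weierstrassFactor (⌈p⌉₊ - 1) (z * l)).prod := by
  have h' : ∀ x, (z • F) x ∈ V := fun x => V.smul_mem z (h x)
  rw [detp_eq p V (z • F) h', restrictTo_smul V F h, det_one_sub_smul_eq_prod_roots]
  simp only [weierstrassFactor]
  rw [Multiset.prod_map_mul]
  congr 1
  set S := (restrictTo V F h).charpoly.roots with hS
  have h1 : ∀ k : ℕ, LinearMap.trace ℂ V ((z • restrictTo V F h) ^ k) / (k : ℂ) =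
      (S.map fun l => (z * l) ^ k / (k : ℂ)).sum := by
    intro k
    rw [smul_pow, map_smul, trace_pow_eq_sum_roots, Multiset.sum_map_div, smul_eq_mul,
      ← Multiset.sum_map_mul_left]
    simp_rw [mul_pow]
    rfl
  simp_rw [h1]
  rw [← Multiset.sum_map_sum, Complex.exp_multiset_sum, Multiset.map_map]
  rfl

lemma detp_zero (p : ℝ) : detp p (0 : X →L[ℂ] X) = 1 := by
  have : FiniteDimensional ℂ (⊥ : Submodule ℂ X) := inferInstance
  have := detp_smul_eq_prod p ⊥ (0 : X →L[ℂ] X) (by simp) 0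
  rw [smul_zero] at this
  rw [this]
  simp only [weierstrassFactor, zero_mul, sub_zero, one_mul, Multiset.map_const', Multiset.prod_replicate]
  rw [Finset.sum_eq_zero, Complex.exp_zero, one_pow]
  intro k hk
  rw [zero_pow (by have := (Finset.mem_Icc.1 hk).1; omega), zero_div]

/-- Regularized determinants depend holomorphically on the coefficients. -/
lemma differentiableOn_detp_mul (p : ℝ) (V : Submodule ℂ X) [FiniteDimensional ℂ V] (F : X →L[ℂ] X)
    (h : ∀ x, F x ∈ V) {T : ℂ → X →L[ℂ] X} {U : Set ℂ} (hT : DifferentiableOn ℂ T U) :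
    DifferentiableOn ℂ (fun z => detp p (F * T z)) U := by
  classical
  let b := Module.finBasis ℂ V
  let Fv : X →L[ℂ] V := F.codRestrict V h
  let M : ℂ → Matrix (Fin (Module.finrank ℂ V)) (Fin (Module.finrank ℂ V)) ℂ := fun z i j =>
    LinearMap.toContinuousLinearMap (b.coord i) (Fv (T z (b j)))
  have hM : ∀ i j, DifferentiableOn ℂ (fun z => M z i j) U := by
    intro i j
    have h1 : DifferentiableOn ℂ (fun z => T z (b j : X)) U := hT.clm_apply (differentiableOn_const _)
    exact (LinearMap.toContinuousLinearMap (b.coord i)).differentiable.comp_differentiableOn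
      (Fv.differentiable.comp_differentiableOn h1)
  have hpow : ∀ (k : ℕ) i j, DifferentiableOn ℂ (fun z => (M z ^ k) i j) U := by
    intro k
    induction k with
    | zero => intro i j; simp
    | succ k ih =>
      intro i j
      simp only [pow_succ, Matrix.mul_apply]
      exact DifferentiableOn.fun_sum fun l _ => (ih i l).mul (hM l j)
  have hmem : ∀ z x, (F * T z) x ∈ V := fun z x => h _
  have hMat : ∀ z, LinearMap.toMatrix b b (restrictTo V (F * T z) (hmem z)) = M z := by
    intro z; ext i j
    rw [LinearMap.toMatrix_apply]; rfl
  have heq : ∀ z, detp p (F * T z) = (1 - M z).det *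
      Complex.exp (∑ k ∈ Finset.Icc 1 (⌈p⌉₊ - 1), (M z ^ k).trace / (k : ℂ)) := by
    intro z
    rw [detp_eq p V _ (hmem z), ← LinearMap.det_toMatrix b, map_sub, LinearMap.toMatrix_one, hMat]
    congr 3
    ext k
    rw [LinearMap.trace_eq_matrix_trace ℂ b, ← LinearMap.toMatrix_pow, hMat]
  simp_rw [heq]
  apply DifferentiableOn.mul
  · simp_rw [Matrix.det_apply]
    refine DifferentiableOn.fun_sum fun σ _ => DifferentiableOn.const_smul ?_ _
    refine DifferentiableOn.fun_finsetProd fun i _ => ?_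
    simp only [Matrix.sub_apply]
    exact (differentiableOn_const _).sub (hM _ _)
  · apply DifferentiableOn.cexp
    refine DifferentiableOn.fun_sum fun k _ => DifferentiableOn.div_const ?_ _
    simp only [Matrix.trace, Matrix.diag]
    exact DifferentiableOn.fun_sum fun i _ => hpow k i i

/-- `det (1 - F)` vanishes exactly when `F` has a nonzero fixed vector. -/
lemma detOneSub_eq_zero_iff {F : X →L[ℂ] X} (hF : IsFiniteRank F) :
    detOneSub F = 0 ↔ ∃ x, x ≠ 0 ∧ F x = x := by
  have : FiniteDimensional ℂ (LinearMap.range (F : X →ₗ[ℂ] X)) := hF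
  rw [detOneSub_eq_det (LinearMap.range (F : X →ₗ[ℂ] X)) F (fun x => LinearMap.mem_range_self _ x),
    LinearMap.det_eq_zero_iff_ker_ne_bot, Submodule.ne_bot_iff]
  constructor
  · rintro ⟨v, hv, hv0⟩
    refine ⟨v, by simpa using hv0, ?_⟩
    rw [LinearMap.mem_ker, LinearMap.sub_apply, sub_eq_zero] at hv
    exact congrArg Subtype.val hv.symm
  · rintro ⟨x, hx, hFx⟩
    refine ⟨⟨x, x, hFx⟩, ?_, by simpa [Subtype.ext_iff] using hx⟩
    rw [LinearMap.mem_ker, LinearMap.sub_apply, sub_eq_zero]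
    exact Subtype.ext hFx.symm

end FiniteRank

section CircleIntegral

variable {E G : Type*} [NormedAddCommGroup E] [NormedSpace ℂ E] [CompleteSpace E]
  [NormedAddCommGroup G] [NormedSpace ℂ G] [CompleteSpace G]

lemma ContinuousLinearMap.circleIntegral_comp_comm (Λ : E →L[ℂ] G) {f : ℂ → E} {c : ℂ} {r : ℝ}
    (hf : CircleIntegrable f c r) : Λ (∮ z in C(c, r), f z) = ∮ z in C(c, r), Λ (f z) := by
  simp only [circleIntegral]
  rw [← ContinuousLinearMap.intervalIntegral_comp_comm _ hf.out]
  simp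

omit [CompleteSpace E] in
lemma circleIntegral_swap {g : ℂ → ℂ → E} {c : ℂ} {r r' : ℝ} (hr : 0 ≤ r) (hr' : 0 ≤ r')
    (hg : ContinuousOn (Function.uncurry g) (Metric.sphere c r' ×ˢ Metric.sphere c r)) :
    (∮ w in C(c, r'), ∮ z in C(c, r), g w z) = ∮ z in C(c, r), ∮ w in C(c, r'), g w z := by
  simp only [circleIntegral, ← intervalIntegral.integral_smul]
  rw [MeasureTheory.intervalIntegral_intervalIntegral_swap]
  · simp_rw [smul_comm (deriv (circleMap c r') _)]
  · refine MeasureTheory.IntegrableOn.mono_set (t := Set.Icc 0 (2 * Real.pi) ×ˢ Set.Icc 0 (2 * Real.pi)) ?_ ?_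
    · refine ContinuousOn.integrableOn_compact (isCompact_Icc.prod isCompact_Icc) ?_
      apply Continuous.continuousOn
      have h1 : Continuous fun q : ℝ × ℝ => g (circleMap c r' q.1) (circleMap c r q.2) := by
        have := hg.comp_continuous (f := fun q : ℝ × ℝ => (circleMap c r' q.1, circleMap c r q.2))
          (by fun_prop) (fun q => ⟨circleMap_mem_sphere c hr' _, circleMap_mem_sphere c hr _⟩)
        exact this
      simp only [deriv_circleMap, Function.uncurry_def]
      exact Continuous.smul (by fun_prop) (Continuous.smul (by fun_prop) h1)
    · rw [Set.uIoc_of_le Real.two_pi_pos.le]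
      exact Set.prod_mono Set.Ioc_subset_Icc_self Set.Ioc_subset_Icc_self

lemma circleIntegral_inv_sub_of_mem_ball {c w : ℂ} {r : ℝ} (hw : w ∈ Metric.ball c r) :
    (∮ z in C(c, r), (w - z)⁻¹) = -(2 * Real.pi * Complex.I) := by
  rw [← circleIntegral.integral_sub_inv_of_mem_ball hw, ← neg_one_mul,
    ← circleIntegral.integral_const_mul]
  congr 1; ext z
  rw [← neg_sub, inv_neg]; ring

lemma circleIntegral_inv_sub_of_notMem_closedBall {c w : ℂ} {r : ℝ} (hr : 0 ≤ r)
    (hw : w ∉ Metric.closedBall c r) : (∮ z in C(c, r), (w - z)⁻¹) = 0 := by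
  have hne : ∀ z ∈ Metric.closedBall c r, w - z ≠ 0 := fun z hz h =>
    hw (by rwa [sub_eq_zero.1 h])
  refine Complex.circleIntegral_eq_zero_of_differentiable_on_off_countable hr Set.countable_empty
    ?_ fun z hz => ?_
  · exact (continuousOn_const.sub continuousOn_id).inv₀ hne
  · exact (differentiableAt_id.const_sub w).inv (hne z (Metric.ball_subset_closedBall hz.1))

end CircleIntegral

section Riesz

variable {T : X →L[ℂ] X} {c : ℂ} {r : ℝ}

omit [CompleteSpace X] in
lemma sub_mul_resolvent {z : ℂ} (hz : z ∈ resolventSet ℂ T) :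
    (algebraMap ℂ (X →L[ℂ] X) z - T) * resolvent T z = 1 := Ring.mul_inverse_cancel _ hz

omit [CompleteSpace X] in
lemma resolvent_mul_sub {z : ℂ} (hz : z ∈ resolventSet ℂ T) :
    resolvent T z * (algebraMap ℂ (X →L[ℂ] X) z - T) = 1 := Ring.inverse_mul_cancel _ hz

omit [CompleteSpace X] in
lemma resolvent_eq_of_mul {z : ℂ} {S : X →L[ℂ] X}
    (h₁ : (algebraMap ℂ (X →L[ℂ] X) z - T) * S = 1)
    (h₂ : S * (algebraMap ℂ (X →L[ℂ] X) z - T) = 1) :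
    z ∈ resolventSet ℂ T ∧ resolvent T z = S := by
  have hz : z ∈ resolventSet ℂ T := spectrum.mem_resolventSet_of_left_right_inverse h₁ h₂
  refine ⟨hz, ?_⟩
  calc resolvent T z = resolvent T z * ((algebraMap ℂ (X →L[ℂ] X) z - T) * S) := by rw [h₁, mul_one]
    _ = S := by rw [← mul_assoc, resolvent_mul_sub hz, one_mul]

lemma differentiableOn_resolvent (T : X →L[ℂ] X) :
    DifferentiableOn ℂ (resolvent T) (resolventSet ℂ T) := fun _ hz =>
  (spectrum.hasDerivAt_resolvent_const_left hz).differentiableAt.differentiableWithinAt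

lemma circleIntegrable_resolvent (hr : 0 ≤ r) (h : Metric.sphere c r ⊆ resolventSet ℂ T) :
    CircleIntegrable (resolvent T) c r :=
  ((differentiableOn_resolvent T).continuousOn.mono h).circleIntegrable hr

/-- The Riesz projection does not depend on the radius as long as no spectrum is crossed. -/
lemma rieszProjection_eq_of_annulus {r' : ℝ} (hr : 0 < r) (hrr' : r ≤ r')
    (h : Metric.closedBall c r' \ Metric.ball c r ⊆ resolventSet ℂ T) :
    rieszProjection T c r' = rieszProjection T c r := by
  rw [rieszProjection, rieszProjection,
    Complex.circleIntegral_eq_of_differentiable_on_annulus_off_countable hr hrr'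
      Set.countable_empty ((differentiableOn_resolvent T).continuousOn.mono h)]
  intro z hz
  exact (spectrum.hasDerivAt_resolvent_const_left (h ⟨Metric.ball_subset_closedBall hz.1.1,
    fun hb => hz.1.2 (Metric.ball_subset_closedBall hb)⟩)).differentiableAt

lemma exists_annulus_subset_resolventSet (hr : 0 < r) (h : Metric.sphere c r ⊆ resolventSet ℂ T) :
    ∃ r' > r, Metric.closedBall c r' \ Metric.ball c r ⊆ resolventSet ℂ T := by
  obtain ⟨δ, hδ, hsub⟩ := (isCompact_sphere c r).exists_cthickening_subset_open
    (spectrum.isOpen_resolventSet T) h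
  refine ⟨r + δ, by linarith, fun z hz => hsub ?_⟩
  have h1 : r ≤ ‖z - c‖ := by simpa [dist_eq_norm] using hz.2
  have h2 : ‖z - c‖ ≤ r + δ := by simpa [dist_eq_norm] using hz.1
  have h0 : 0 < ‖z - c‖ := hr.trans_le h1
  have hn : ((‖z - c‖ : ℝ) : ℂ) ≠ 0 := by exact_mod_cast h0.ne'
  refine Metric.mem_cthickening_of_dist_le z (c + (r / ‖z - c‖ : ℝ) • (z - c)) δ _ ?_ ?_
  · rw [mem_sphere_iff_norm, add_sub_cancel_left, norm_smul, Real.norm_of_nonneg (by positivity)]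
    field_simp
  · have : z - (c + (r / ‖z - c‖ : ℝ) • (z - c)) = (1 - r / ‖z - c‖ : ℝ) • (z - c) := by
      rw [sub_smul, one_smul]; abel
    rw [dist_eq_norm, this, norm_smul, Real.norm_of_nonneg, sub_mul, one_mul,
      div_mul_cancel₀ _ h0.ne']
    · linarith
    · rw [sub_nonneg, div_le_one h0]; exact h1

omit [CompleteSpace X] in
lemma resolvent_mul_resolvent {w z : ℂ} (hw : w ∈ resolventSet ℂ T) (hz : z ∈ resolventSet ℂ T)
    (hne : w ≠ z) :
    resolvent T w * resolvent T z = (z - w)⁻¹ • resolvent T w - (z - w)⁻¹ • resolvent T z := by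
  have h0 : z - w ≠ 0 := sub_ne_zero.2 hne.symm
  have : (z - w) • (resolvent T w * resolvent T z) = resolvent T w - resolvent T z := by
    have h1 : resolvent T w * ((algebraMap ℂ (X →L[ℂ] X) z - T) -
        (algebraMap ℂ (X →L[ℂ] X) w - T)) * resolvent T z = resolvent T w - resolvent T z := by
      rw [mul_sub, sub_mul, mul_assoc, sub_mul_resolvent hz, resolvent_mul_sub hw, mul_one, one_mul]
    rw [← h1, sub_sub_sub_cancel_right, ← map_sub, Algebra.algebraMap_eq_smul_one, mul_smul_comm,
      mul_one, smul_mul_assoc]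
  rw [← smul_sub, ← this, smul_smul, inv_mul_cancel₀ h0, one_smul]

lemma rieszProjection_mul_self (hr : 0 < r) (h : Metric.sphere c r ⊆ resolventSet ℂ T) :
    rieszProjection T c r * rieszProjection T c r = rieszProjection T c r := by
  obtain ⟨r', hr', hann⟩ := exists_annulus_subset_resolventSet hr h
  have hs' : Metric.sphere c r' ⊆ resolventSet ℂ T := fun z hz =>
    hann ⟨Metric.sphere_subset_closedBall hz, by
      rw [Metric.mem_sphere] at hz; rw [Metric.mem_ball, hz]; exact not_lt.2 hr'.le⟩
  have hr0 : 0 < r' := hr.trans hr'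
  have hcont := (differentiableOn_resolvent T).continuousOn
  have hne : ∀ w ∈ Metric.sphere c r', ∀ z ∈ Metric.sphere c r, w ≠ z := by
    rintro w hw _ hz rfl
    rw [Metric.mem_sphere] at hw hz; linarith
  set J : X →L[ℂ] X := ∮ z in C(c, r), resolvent T z with hJ
  have hpi : (2 * Real.pi * Complex.I : ℂ) ≠ 0 := by simp [Real.pi_ne_zero]
  have hJ' : (∮ w in C(c, r'), resolvent T w) = J :=
    Complex.circleIntegral_eq_of_differentiable_on_annulus_off_countable hr hr'.le
      Set.countable_empty (hcont.mono hann) fun z hz =>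
        (spectrum.hasDerivAt_resolvent_const_left (hann ⟨Metric.ball_subset_closedBall hz.1.1,
          fun hb => hz.1.2 (Metric.ball_subset_closedBall hb)⟩)).differentiableAt
  have hI : CircleIntegrable (resolvent T) c r := circleIntegrable_resolvent hr.le h
  have hinv : ∀ w ∈ Metric.sphere c r', ContinuousOn (fun z => (z - w)⁻¹) (Metric.sphere c r) :=
    fun w hw => (continuousOn_id.sub continuousOn_const).inv₀ fun z hz =>
      sub_ne_zero.2 (hne w hw z hz).symm
  have key : J * J = (2 * Real.pi * Complex.I : ℂ) • J := by
    have e1 : J * J = ∮ w in C(c, r'), resolvent T w * J := by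
      rw [← congrArg (· * J) hJ']
      exact ((ContinuousLinearMap.mul ℂ (X →L[ℂ] X)).flip J).circleIntegral_comp_comm
        (circleIntegrable_resolvent hr0.le hs')
    have e2 : ∀ w ∈ Metric.sphere c r', resolvent T w * J =
        -∮ z in C(c, r), (z - w)⁻¹ • resolvent T z := by
      intro w hw
      refine ((ContinuousLinearMap.mul ℂ (X →L[ℂ] X) (resolvent T w)).circleIntegral_comp_comm
        hI).trans ?_
      have : (∮ z in C(c, r), (z - w)⁻¹ • resolvent T w - (z - w)⁻¹ • resolvent T z) =
          -∮ z in C(c, r), (z - w)⁻¹ • resolvent T z := by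
        rw [circleIntegral.integral_sub, circleIntegral.integral_smul_const]
        · have hw' : w ∉ Metric.closedBall c r := by
            rw [Metric.mem_sphere] at hw; rw [Metric.mem_closedBall, hw]; exact not_le.2 hr'
          have : (∮ z in C(c, r), (z - w)⁻¹) = 0 := by
            rw [← neg_eq_zero, ← circleIntegral_inv_sub_of_notMem_closedBall hr.le hw',
              ← neg_one_mul, ← circleIntegral.integral_const_mul]
            congr 1; ext z
            rw [← neg_sub, inv_neg]; ring
          rw [this, zero_smul, zero_sub]
        · exact ((hinv w hw).smul continuousOn_const).circleIntegrable hr.le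
        · exact ((hinv w hw).smul (hcont.mono h)).circleIntegrable hr.le
      rw [← this]
      refine circleIntegral.integral_congr hr.le fun z hz => ?_
      exact resolvent_mul_resolvent (hs' hw) (h hz) (hne w hw z hz)
    rw [e1, circleIntegral.integral_congr hr0.le e2]
    have e3 : (∮ w in C(c, r'), -∮ z in C(c, r), (z - w)⁻¹ • resolvent T z) =
        ∮ w in C(c, r'), ∮ z in C(c, r), (w - z)⁻¹ • resolvent T z := by
      congr 1; ext1 w
      rw [← neg_one_smul ℂ, ← circleIntegral.integral_smul]
      congr 1; ext1 z
      rw [← neg_sub w z, inv_neg, neg_smul, neg_smul, smul_neg, one_smul, neg_neg]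
    rw [e3, circleIntegral_swap hr.le hr0.le]
    · rw [hJ, ← circleIntegral.integral_smul]
      refine circleIntegral.integral_congr hr.le fun z hz => ?_
      rw [circleIntegral.integral_smul_const, circleIntegral.integral_sub_inv_of_mem_ball]
      rw [Metric.mem_sphere] at hz; rw [Metric.mem_ball, hz]; exact hr'
    · simp only [Function.uncurry_def]
      refine ContinuousOn.smul (ContinuousOn.inv₀
        (continuousOn_fst.sub continuousOn_snd) ?_) ?_
      · rintro ⟨w, z⟩ ⟨hw, hz⟩
        exact sub_ne_zero.2 (hne w hw z hz)
      · exact hcont.comp continuousOn_snd fun q hq => h hq.2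
  rw [rieszProjection, ← hJ, smul_mul_smul_comm, key, smul_smul, mul_assoc, inv_mul_cancel₀ hpi,
    mul_one]

/-- The Cauchy transform of the resolvent along a circle. -/
noncomputable def rieszCauchy (T : X →L[ℂ] X) (c : ℂ) (r : ℝ) (w : ℂ) : X →L[ℂ] X :=
  (2 * Real.pi * Complex.I)⁻¹ • ∮ z in C(c, r), (w - z)⁻¹ • resolvent T z

lemma sub_mul_rieszCauchy (hr : 0 < r) (h : Metric.sphere c r ⊆ resolventSet ℂ T) {w : ℂ}
    (hw : w ∉ Metric.sphere c r) :
    (algebraMap ℂ (X →L[ℂ] X) w - T) * rieszCauchy T c r w = rieszProjection T c r +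
      ((2 * Real.pi * Complex.I)⁻¹ * ∮ z in C(c, r), (w - z)⁻¹) • 1 ∧
    rieszCauchy T c r w * (algebraMap ℂ (X →L[ℂ] X) w - T) = rieszProjection T c r +
      ((2 * Real.pi * Complex.I)⁻¹ * ∮ z in C(c, r), (w - z)⁻¹) • 1 := by
  have hne : ∀ z ∈ Metric.sphere c r, w - z ≠ 0 := fun z hz h0 =>
    hw (by rwa [sub_eq_zero.1 h0])
  have hcont := (differentiableOn_resolvent T).continuousOn.mono h
  have hinv : ContinuousOn (fun z => (w - z)⁻¹) (Metric.sphere c r) :=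
    (continuousOn_const.sub continuousOn_id).inv₀ hne
  have hI : CircleIntegrable (fun z => (w - z)⁻¹ • resolvent T z) c r :=
    (hinv.smul hcont).circleIntegrable hr.le
  have hsum : (∮ z in C(c, r), (resolvent T z + (w - z)⁻¹ • (1 : X →L[ℂ] X))) =
      (∮ z in C(c, r), resolvent T z) + (∮ z in C(c, r), (w - z)⁻¹) • 1 := by
    have hI' : CircleIntegrable (fun z => (w - z)⁻¹ • (1 : X →L[ℂ] X)) c r :=
      (hinv.smul continuousOn_const).circleIntegrable hr.le
    rw [circleIntegral.integral_add (hcont.circleIntegrable hr.le) hI',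
      circleIntegral.integral_smul_const]
  have hsplit : ∀ z, algebraMap ℂ (X →L[ℂ] X) w - T =
      (w - z) • (1 : X →L[ℂ] X) + (algebraMap ℂ (X →L[ℂ] X) z - T) := by
    intro z
    rw [Algebra.algebraMap_eq_smul_one, Algebra.algebraMap_eq_smul_one, sub_smul]; abel
  constructor
  · rw [rieszCauchy, rieszProjection, mul_smul_comm, mul_smul, ← smul_add, ← hsum]
    congr 1
    refine ((ContinuousLinearMap.mul ℂ (X →L[ℂ] X) _).circleIntegral_comp_comm hI).trans ?_
    refine circleIntegral.integral_congr hr.le fun z hz => ?_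
    simp only [ContinuousLinearMap.mul_apply']
    rw [mul_smul_comm, hsplit z, add_mul, sub_mul_resolvent (h hz), smul_add, smul_mul_assoc,
      one_mul, smul_smul, inv_mul_cancel₀ (hne z hz), one_smul]
  · rw [rieszCauchy, rieszProjection, smul_mul_assoc, mul_smul, ← smul_add, ← hsum]
    congr 1
    refine (((ContinuousLinearMap.mul ℂ (X →L[ℂ] X)).flip _).circleIntegral_comp_comm hI).trans ?_
    refine circleIntegral.integral_congr hr.le fun z hz => ?_
    simp only [ContinuousLinearMap.flip_apply, ContinuousLinearMap.mul_apply']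
    rw [smul_mul_assoc, hsplit z, mul_add, resolvent_mul_sub (h hz), smul_add, mul_smul_comm,
      mul_one, smul_smul, inv_mul_cancel₀ (hne z hz), one_smul]

lemma rieszCauchy_of_notMem_closedBall (hr : 0 < r) (h : Metric.sphere c r ⊆ resolventSet ℂ T)
    {w : ℂ} (hw : w ∉ Metric.closedBall c r) :
    (algebraMap ℂ (X →L[ℂ] X) w - T) * rieszCauchy T c r w = rieszProjection T c r ∧
    rieszCauchy T c r w * (algebraMap ℂ (X →L[ℂ] X) w - T) = rieszProjection T c r := by
  have := sub_mul_rieszCauchy hr h fun hs => hw (Metric.sphere_subset_closedBall hs)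
  simpa only [circleIntegral_inv_sub_of_notMem_closedBall hr.le hw, mul_zero, zero_smul, add_zero]
    using this

lemma rieszCauchy_of_mem_ball (hr : 0 < r) (h : Metric.sphere c r ⊆ resolventSet ℂ T)
    {w : ℂ} (hw : w ∈ Metric.ball c r) :
    (algebraMap ℂ (X →L[ℂ] X) w - T) * rieszCauchy T c r w = rieszProjection T c r - 1 ∧
    rieszCauchy T c r w * (algebraMap ℂ (X →L[ℂ] X) w - T) = rieszProjection T c r - 1 := by
  have hpi : (2 * Real.pi * Complex.I : ℂ) ≠ 0 := by simp [Real.pi_ne_zero]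
  have := sub_mul_rieszCauchy hr h fun hs =>
    (Metric.mem_ball.1 hw).ne (Metric.mem_sphere.1 hs)
  simpa only [circleIntegral_inv_sub_of_mem_ball hw, mul_neg, inv_mul_cancel₀ hpi, neg_smul,
    one_smul, ← sub_eq_add_neg] using this

omit [CompleteSpace X] in
lemma commute_resolvent {S : X →L[ℂ] X} {z : ℂ} (hz : z ∈ resolventSet ℂ T) (hS : Commute S T) :
    Commute S (resolvent T z) := by
  rw [spectrum.resolvent_eq hz]
  refine Commute.units_inv_right ?_
  rw [hz.unit_spec]
  exact ((Algebra.commute_algebraMap_left z S).symm).sub_right hS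

lemma commute_rieszProjection {S : X →L[ℂ] X} (hr : 0 ≤ r)
    (h : Metric.sphere c r ⊆ resolventSet ℂ T)
    (hS : Commute S T) : Commute S (rieszProjection T c r) := by
  have hI := circleIntegrable_resolvent hr h
  rw [rieszProjection]
  refine Commute.smul_right ?_ _
  rw [Commute, SemiconjBy]
  refine ((ContinuousLinearMap.mul ℂ (X →L[ℂ] X) S).circleIntegral_comp_comm hI).trans
    (Eq.trans ?_ (((ContinuousLinearMap.mul ℂ (X →L[ℂ] X)).flip S).circleIntegral_comp_comm hI).symm)
  refine circleIntegral.integral_congr hr fun z hz => ?_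
  exact commute_resolvent (h hz) hS

end Riesz

section Compact

variable {T : X →L[ℂ] X} {c : ℂ} {r : ℝ}

omit [CompleteSpace X] in
lemma IsFiniteRank.isCompactOperator {F : X →L[ℂ] X} (hF : IsFiniteRank F) :
    IsCompactOperator F := by
  have : FiniteDimensional ℂ (LinearMap.range (F : X →ₗ[ℂ] X)) := hF
  have : ProperSpace (LinearMap.range (F : X →ₗ[ℂ] X)) := FiniteDimensional.proper ℂ _
  exact (isCompactOperator_of_locallyCompactSpace_dom
    (F.codRestrict (LinearMap.range (F : X →ₗ[ℂ] X)) fun x => LinearMap.mem_range_self _ x)).clm_comp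
    (LinearMap.range (F : X →ₗ[ℂ] X)).subtypeL

omit [CompleteSpace X] in
lemma isFiniteRank_of_isCompactOperator_of_mul_self {P : X →L[ℂ] X} (hP : IsCompactOperator P)
    (hPP : P * P = P) : IsFiniteRank P := by
  have hfix : ∀ x ∈ LinearMap.range (P : X →ₗ[ℂ] X), P x = x := by
    rintro _ ⟨x, rfl⟩; exact DFunLike.congr_fun hPP x
  have hcl : IsClosed (LinearMap.range (P : X →ₗ[ℂ] X) : Set X) := by
    have : (LinearMap.range (P : X →ₗ[ℂ] X) : Set X) = {x | P x = x} := by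
      ext x; exact ⟨hfix x, fun h => ⟨x, h⟩⟩
    rw [this]; exact isClosed_eq P.continuous continuous_id
  have h1 := (hP.codRestrict (fun x => LinearMap.mem_range_self (P : X →ₗ[ℂ] X) x) hcl).comp_clm
    (LinearMap.range (P : X →ₗ[ℂ] X)).subtypeL
  refine FiniteDimensional.of_isCompactOperator_id (𝕜 := ℂ) ?_
  have e : (id : LinearMap.range (P : X →ₗ[ℂ] X) → LinearMap.range (P : X →ₗ[ℂ] X)) =
      (Set.codRestrict P (LinearMap.range (P : X →ₗ[ℂ] X))
        fun x => LinearMap.mem_range_self (P : X →ₗ[ℂ] X) x) ∘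
      (LinearMap.range (P : X →ₗ[ℂ] X)).subtypeL :=
    funext fun x => Subtype.ext (hfix x x.2).symm
  rw [e]
  exact h1

omit [CompleteSpace X] in
lemma IsFiniteRank.mul_left {F : X →L[ℂ] X} (hF : IsFiniteRank F) (A : X →L[ℂ] X) :
    IsFiniteRank (A * F) := by
  have : FiniteDimensional ℂ (LinearMap.range (F : X →ₗ[ℂ] X)) := hF
  refine isFiniteRank_of_forall_mem ((LinearMap.range (F : X →ₗ[ℂ] X)).map (A : X →ₗ[ℂ] X))
    fun x => ⟨F x, ⟨x, rfl⟩, rfl⟩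

omit [CompleteSpace X] in
lemma IsFiniteRank.mul_right {F : X →L[ℂ] X} (hF : IsFiniteRank F) (A : X →L[ℂ] X) :
    IsFiniteRank (F * A) := by
  have : FiniteDimensional ℂ (LinearMap.range (F : X →ₗ[ℂ] X)) := hF
  exact isFiniteRank_of_forall_mem (LinearMap.range (F : X →ₗ[ℂ] X)) fun x => ⟨A x, rfl⟩

omit [CompleteSpace X] in
lemma IsFiniteRank.add {F G : X →L[ℂ] X} (hF : IsFiniteRank F) (hG : IsFiniteRank G) :
    IsFiniteRank (F + G) := by
  have : FiniteDimensional ℂ (LinearMap.range (F : X →ₗ[ℂ] X)) := hF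
  have : FiniteDimensional ℂ (LinearMap.range (G : X →ₗ[ℂ] X)) := hG
  exact isFiniteRank_of_forall_mem
    (LinearMap.range (F : X →ₗ[ℂ] X) ⊔ LinearMap.range (G : X →ₗ[ℂ] X))
    fun x => Submodule.add_mem_sup ⟨x, rfl⟩ ⟨x, rfl⟩

omit [CompleteSpace X] in
lemma IsFiniteRank.smul {F : X →L[ℂ] X} (hF : IsFiniteRank F) (a : ℂ) : IsFiniteRank (a • F) := by
  simpa using hF.mul_left (a • (1 : X →L[ℂ] X))

omit [CompleteSpace X] in
lemma isFiniteRank_zero : IsFiniteRank (0 : X →L[ℂ] X) :=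
  isFiniteRank_of_forall_mem ⊥ (by simp)

lemma isUnit_one_sub_of_detOneSub_ne_zero {F : X →L[ℂ] X} (hF : IsFiniteRank F)
    (h : detOneSub F ≠ 0) : IsUnit (1 - F) := by
  rcases hF.isCompactOperator.hasEigenvalue_or_mem_resolventSet (one_ne_zero (α := ℂ)) with h1 | h1
  · obtain ⟨x, hx⟩ := h1.exists_hasEigenvector
    refine absurd ((detOneSub_eq_zero_iff hF).2 ⟨x, hx.2, ?_⟩) h
    simpa using hx.apply_eq_smul
  · simpa [spectrum.mem_resolventSet_iff] using h1

/-- The spectrum of a norm limit of finite rank operators accumulates only at `0`. -/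
lemma finite_spectrum_of_approx (hT : ∀ ε > 0, ∃ F : X →L[ℂ] X, IsFiniteRank F ∧ ‖T - F‖ < ε)
    {s : ℝ} (hs : 0 < s) : {z ∈ spectrum ℂ T | s ≤ ‖z‖}.Finite := by
  obtain ⟨F, hF, hFT⟩ := hT (s / 2) (by positivity)
  set G := T - F with hG
  have hfd : FiniteDimensional ℂ (LinearMap.range (F : X →ₗ[ℂ] X)) := hF
  set U := Metric.ball (0 : ℂ) (2 / s)
  have hunit : ∀ w ∈ U, IsUnit (1 - w • G) := by
    intro w hw
    have hw' : ‖w‖ < 2 / s := by simpa [U] using hw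
    refine isUnit_one_sub_of_norm_lt_one ?_
    calc ‖w • G‖ ≤ ‖w‖ * ‖G‖ := (norm_smul w G).le
      _ ≤ (2 / s) * ‖G‖ := by gcongr
      _ < (2 / s) * (s / 2) := by gcongr
      _ = 1 := by field_simp
  let S : ℂ → X →L[ℂ] X := fun w => w • Ring.inverse (1 - w • G)
  have hS : DifferentiableOn ℂ S U := by
    intro w hw
    refine DifferentiableAt.differentiableWithinAt ?_
    refine DifferentiableAt.fun_smul differentiableAt_fun_id ?_
    refine DifferentiableAt.comp w (f := fun w : ℂ => 1 - w • G) (differentiableAt_inverse (hunit w hw)) ?_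
    fun_prop
  let d : ℂ → ℂ := fun w => detp 1 (F * S w)
  have hd : AnalyticOnNhd ℂ d U :=
    (differentiableOn_detp_mul 1 _ F (fun x => LinearMap.mem_range_self _ x) hS).analyticOnNhd
      Metric.isOpen_ball
  have hd0 : d 0 = 1 := by simp [d, S, detp_zero]
  have hdet : ∀ A : X →L[ℂ] X, detp 1 A = detOneSub A := by intro A; simp [detp]
  have hZ : {w ∈ Metric.closedBall (0 : ℂ) (1 / s) | d w = 0}.Finite := by
    by_contra hinf
    obtain ⟨x, hx, hacc⟩ := Set.Infinite.exists_accPt_of_subset_isCompact hinf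
      (isCompact_closedBall (0 : ℂ) (1 / s)) (Set.sep_subset _ _)
    have hsub : Metric.closedBall (0 : ℂ) (1 / s) ⊆ U :=
      Metric.closedBall_subset_ball (by gcongr; norm_num)
    have := hd.eqOn_zero_of_preconnected_of_frequently_eq_zero
      (convex_ball (0 : ℂ) (2 / s)).isPreconnected (hsub hx)
      ((accPt_iff_frequently_nhdsNE.1 hacc).mono fun y hy => hy.2)
    have h0 := this (x := 0) (Metric.mem_ball_self (by positivity))
    rw [hd0] at h0; exact one_ne_zero h0
  refine (hZ.image (fun w => w⁻¹)).subset ?_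
  rintro z ⟨hz, hsz⟩
  have hz0 : 0 < ‖z‖ := hs.trans_le hsz
  have hzne : z ≠ 0 := norm_pos_iff.1 hz0
  refine ⟨z⁻¹, ⟨?_, ?_⟩, inv_inv z⟩
  · rw [mem_closedBall_zero_iff, norm_inv, ← one_div]; gcongr
  · by_contra hne
    have hwU : z⁻¹ ∈ U := by
      rw [mem_ball_zero_iff, norm_inv, ← one_div]
      exact lt_of_le_of_lt (one_div_le_one_div_of_le hs hsz) (by gcongr; norm_num)
    have hu := (isUnit_one_sub_of_detOneSub_ne_zero (hF.mul_right (S z⁻¹))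
      (by rwa [← hdet])).mul (hunit _ hwU)
    have e : (1 - F * S z⁻¹) * (1 - z⁻¹ • G) = z⁻¹ • (algebraMap ℂ (X →L[ℂ] X) z - T) := by
      have h1 : F * S z⁻¹ * (1 - z⁻¹ • G) = z⁻¹ • F := by
        simp only [S]
        rw [mul_assoc, smul_mul_assoc, Ring.inverse_mul_cancel _ (hunit _ hwU), mul_smul_comm,
          mul_one]
      rw [sub_mul, h1, one_mul, smul_sub z⁻¹ (algebraMap ℂ (X →L[ℂ] X) z),
        Algebra.algebraMap_eq_smul_one, smul_smul, inv_mul_cancel₀ hzne, one_smul, hG, smul_sub]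
      abel
    rw [e] at hu
    refine hz ?_
    have := hu.smul (Units.mk0 z hzne)
    rw [spectrum.mem_resolventSet_iff]
    simpa [Units.smul_def, smul_smul, hzne] using this

lemma isFiniteRank_rieszProjection (hT : IsCompactOperator T) (hr : 0 < r)
    (h : Metric.sphere c r ⊆ resolventSet ℂ T) (h0 : 0 ∉ Metric.closedBall c r) :
    IsFiniteRank (rieszProjection T c r) := by
  refine isFiniteRank_of_isCompactOperator_of_mul_self ?_ (rieszProjection_mul_self hr h)
  rw [← (rieszCauchy_of_notMem_closedBall hr h h0).1, map_zero, zero_sub]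
  exact hT.neg.comp_clm (rieszCauchy T c r 0)

lemma isFiniteRank_one_sub_rieszProjection (hT : IsCompactOperator T) (hr : 0 < r)
    (h : Metric.sphere c r ⊆ resolventSet ℂ T) (h0 : 0 ∈ Metric.ball c r) :
    IsFiniteRank (1 - rieszProjection T c r) := by
  refine isFiniteRank_of_isCompactOperator_of_mul_self ?_ ?_
  · have : 1 - rieszProjection T c r = T * rieszCauchy T c r 0 := by
      rw [← neg_sub, ← (rieszCauchy_of_mem_ball hr h h0).1, map_zero, zero_sub, neg_mul, neg_neg]
    rw [this]
    exact hT.comp_clm (rieszCauchy T c r 0)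
  · rw [mul_sub, sub_mul, sub_mul, rieszProjection_mul_self hr h]; simp

omit [CompleteSpace X] in
/-- The resolvent of a block of an operator that commutes with a projection. -/
lemma resolvent_block {P B : X →L[ℂ] X} (hPP : P * P = P) (hPT : Commute P T) {w : ℂ} (hw : w ≠ 0)
    (h₁ : P * ((algebraMap ℂ (X →L[ℂ] X) w - T) * B) * P = P)
    (h₂ : P * (B * (algebraMap ℂ (X →L[ℂ] X) w - T)) * P = P) :
    w ∈ resolventSet ℂ (P * T) ∧
      resolvent (P * T) w = P * B * P + w⁻¹ • (1 - P) := by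
  have hc : Commute P (algebraMap ℂ (X →L[ℂ] X) w - T) :=
    (Algebra.commute_algebraMap_right w P).sub_right hPT
  set D := algebraMap ℂ (X →L[ℂ] X) w - T with hD
  have e : algebraMap ℂ (X →L[ℂ] X) w - P * T = P * D + w • (1 - P) := by
    rw [hD, mul_sub, Algebra.algebraMap_eq_smul_one, mul_smul_comm, mul_one, smul_sub]; abel
  have hQ : P * (1 - P) = 0 := by rw [mul_sub, hPP, mul_one, sub_self]
  have hQ' : (1 - P) * P = 0 := by rw [sub_mul, hPP, one_mul, sub_self]
  have hQQ : (1 - P) * (1 - P) = 1 - P := by rw [mul_sub, hQ', mul_one, sub_zero]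
  apply resolvent_eq_of_mul
  · rw [e, add_mul, mul_add, mul_add, smul_mul_smul_comm, hQQ, mul_inv_cancel₀ hw, one_smul]
    have a1 : P * D * (P * B * P) = P := by
      rw [hc.eq, mul_assoc D, ← mul_assoc P, ← mul_assoc P, hPP, ← mul_assoc, ← mul_assoc,
        ← hc.eq, mul_assoc P, h₁]
    have a2 : P * D * (w⁻¹ • (1 - P)) = 0 := by
      rw [hc.eq, mul_assoc, mul_smul_comm, hQ, smul_zero, mul_zero]
    have a3 : w • (1 - P) * (P * B * P) = 0 := by
      rw [smul_mul_assoc, ← mul_assoc, ← mul_assoc, hQ', zero_mul, zero_mul, smul_zero]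
    rw [a1, a2, a3]; abel
  · rw [e, add_mul, mul_add, mul_add, smul_mul_smul_comm, hQQ, inv_mul_cancel₀ hw, one_smul]
    have a1 : P * B * P * (P * D) = P := by
      rw [mul_assoc (P * B), ← mul_assoc P P, hPP, hc.eq, ← mul_assoc, mul_assoc P, h₂]
    have a2 : P * B * P * (w • (1 - P)) = 0 := by
      rw [mul_assoc, mul_smul_comm, hQ, smul_zero, mul_zero]
    have a3 : w⁻¹ • (1 - P) * (P * D) = 0 := by
      rw [smul_mul_assoc, ← mul_assoc, hQ', zero_mul, smul_zero]
    rw [a1, a2, a3]; abel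

omit [CompleteSpace X] in
lemma resolvent_block_of_mem {P : X →L[ℂ] X} (hPP : P * P = P) (hPT : Commute P T) {w : ℂ}
    (hw : w ≠ 0) (hwT : w ∈ resolventSet ℂ T) :
    w ∈ resolventSet ℂ (P * T) ∧
      resolvent (P * T) w = P * resolvent T w * P + w⁻¹ • (1 - P) :=
  resolvent_block hPP hPT hw (by rw [sub_mul_resolvent hwT, mul_one, hPP])
    (by rw [resolvent_mul_sub hwT, mul_one, hPP])

lemma rieszProjection_block {P : X →L[ℂ] X} (hPP : P * P = P) (hPT : Commute P T) (hr : 0 < r)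
    (h : Metric.sphere c r ⊆ resolventSet ℂ T) (h0 : 0 ∉ Metric.closedBall c r) :
    rieszProjection (P * T) c r = P * rieszProjection T c r * P := by
  have hne : ∀ z ∈ Metric.sphere c r, z ≠ 0 := by
    rintro z hz rfl; exact h0 (Metric.sphere_subset_closedBall hz)
  have hI := circleIntegrable_resolvent hr.le h
  have hcont := (differentiableOn_resolvent T).continuousOn.mono h
  have e1 : (∮ z in C(c, r), resolvent (P * T) z) =
      ∮ z in C(c, r), (P * resolvent T z * P + z⁻¹ • (1 - P)) :=
    circleIntegral.integral_congr hr.le fun z hz =>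
      (resolvent_block_of_mem hPP hPT (hne z hz) (h hz)).2
  have i1 : CircleIntegrable (fun z => P * resolvent T z * P) c r :=
    ((continuousOn_const.mul hcont).mul continuousOn_const).circleIntegrable hr.le
  have i2 : CircleIntegrable (fun z => z⁻¹ • (1 - P)) c r :=
    ((continuousOn_id.inv₀ hne).smul continuousOn_const).circleIntegrable hr.le
  have e2 : (∮ z in C(c, r), z⁻¹) = 0 := by
    have := circleIntegral_inv_sub_of_notMem_closedBall hr.le h0
    rw [← neg_eq_zero, ← this, ← neg_one_mul, ← circleIntegral.integral_const_mul]
    congr 1; ext z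
    rw [zero_sub, inv_neg]; ring
  rw [rieszProjection, e1, circleIntegral.integral_add i1 i2, circleIntegral.integral_smul_const,
    e2, zero_smul, add_zero, rieszProjection, mul_smul_comm, smul_mul_assoc]
  congr 1
  exact (((ContinuousLinearMap.mulLeftRight ℂ (X →L[ℂ] X)) P P).circleIntegral_comp_comm hI).symm

/-- The algebraic multiplicity may be computed with any isolating radius. -/
lemma algebraicMultiplicity_eq {μ : ℂ} (hr : 0 < r)
    (h : ∀ z ∈ Metric.closedBall μ r, z ≠ μ → z ∉ spectrum ℂ T) :
    algebraicMultiplicity T μ =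
      Module.finrank ℂ (LinearMap.range (rieszProjection T μ r : X →ₗ[ℂ] X)) := by
  have hex : ∃ r, 0 < r ∧ ∀ z ∈ Metric.closedBall μ r, z ≠ μ → z ∉ spectrum ℂ T := ⟨r, hr, h⟩
  have key : ∀ {a b : ℝ}, 0 < a → a ≤ b →
      (∀ z ∈ Metric.closedBall μ b, z ≠ μ → z ∉ spectrum ℂ T) →
      rieszProjection T μ b = rieszProjection T μ a := by
    intro a b ha hab hb
    refine rieszProjection_eq_of_annulus ha hab ?_
    rintro z ⟨hz, hz'⟩
    have : z ≠ μ := by rintro rfl; exact hz' (Metric.mem_ball_self ha)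
    exact spectrum.notMem_iff.1 (hb z hz this)
  have e : rieszProjection T μ hex.choose = rieszProjection T μ r := by
    rcases le_total hex.choose r with hle | hle
    · exact (key hex.choose_spec.1 hle h).symm
    · exact key hr hle hex.choose_spec.2
  rw [algebraicMultiplicity, dif_pos hex, e]

omit [CompleteSpace X] in
lemma finrank_range_mul_mul_le {P A : X →L[ℂ] X} (hA : IsFiniteRank A) :
    Module.finrank ℂ (LinearMap.range ((P * A * P : X →L[ℂ] X) : X →ₗ[ℂ] X)) ≤
      Module.finrank ℂ (LinearMap.range (A : X →ₗ[ℂ] X)) := by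
  have : FiniteDimensional ℂ (LinearMap.range (A : X →ₗ[ℂ] X)) := hA
  have hle : LinearMap.range ((P * A * P : X →L[ℂ] X) : X →ₗ[ℂ] X) ≤
      (LinearMap.range (A : X →ₗ[ℂ] X)).map (P : X →ₗ[ℂ] X) := by
    rintro _ ⟨x, rfl⟩; exact ⟨A (P x), ⟨P x, rfl⟩, rfl⟩
  exact (Submodule.finrank_mono hle).trans (Submodule.finrank_map_le _ _)

/-- Cutting an operator down by a commuting projection does not increase its eigenvalue sum. -/
lemma eigSum_block_le {p : ℝ} (hp : 0 < p) {P : X →L[ℂ] X} (hPP : P * P = P) (hPT : Commute P T)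
    (hT : ∀ ε > 0, ∃ F : X →L[ℂ] X, IsFiniteRank F ∧ ‖T - F‖ < ε) (hTc : IsCompactOperator T) :
    eigSum p (P * T) ≤ eigSum p T := by
  refine (tsum_subtype {μ | IsDiscreteEigenvalue (P * T) μ}
      (fun μ => (algebraicMultiplicity (P * T) μ : ℝ≥0∞) * ENNReal.ofReal (‖μ‖ ^ p))).le.trans
    (le_trans ?_ (tsum_subtype {μ | IsDiscreteEigenvalue T μ}
      (fun μ => (algebraicMultiplicity T μ : ℝ≥0∞) * ENNReal.ofReal (‖μ‖ ^ p))).ge)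
  refine ENNReal.tsum_le_tsum fun μ => ?_
  by_cases hμ : IsDiscreteEigenvalue (P * T) μ
  swap
  · rw [Set.indicator_of_notMem (by exact hμ)]; exact zero_le
  rw [Set.indicator_of_mem (by exact hμ)]
  rcases eq_or_ne μ 0 with rfl | hμ0
  · simp [Real.zero_rpow hp.ne']
  have hn : 0 < ‖μ‖ := norm_pos_iff.2 hμ0
  have hfin := finite_spectrum_of_approx hT (half_pos hn)
  have hμT : μ ∈ spectrum ℂ T := fun hres => hμ.1 (resolvent_block_of_mem hPP hPT hμ0 hres).1
  obtain ⟨ε, hε, hball⟩ := Metric.isOpen_iff.1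
    ((hfin.subset (Set.sdiff_subset (t := {μ}))).isClosed.isOpen_compl) μ (by simp)
  set ρ := min (ε / 2) (‖μ‖ / 4) with hρ
  have hρ0 : 0 < ρ := by positivity
  have hlarge : ∀ z ∈ Metric.closedBall μ ρ, ‖μ‖ / 2 ≤ ‖z‖ := by
    intro z hz
    have h1 : ‖μ - z‖ ≤ ‖μ‖ / 4 := by
      rw [← dist_eq_norm, dist_comm]; exact (Metric.mem_closedBall.1 hz).trans (min_le_right _ _)
    have := norm_sub_norm_le μ z
    linarith
  have hiso : ∀ z ∈ Metric.closedBall μ ρ, z ≠ μ → z ∉ spectrum ℂ T := by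
    intro z hz hne hzs
    have h1 : z ∈ Metric.ball μ ε :=
      Metric.closedBall_subset_ball ((min_le_left _ _).trans_lt (half_lt_self hε)) hz
    exact hball h1 ⟨⟨hzs, hlarge z hz⟩, hne⟩
  have h0 : (0 : ℂ) ∉ Metric.closedBall μ ρ := by
    intro h; have := hlarge 0 h; rw [norm_zero] at this; linarith
  have hisoP : ∀ z ∈ Metric.closedBall μ ρ, z ≠ μ → z ∉ spectrum ℂ (P * T) := by
    intro z hz hne hzs
    have hz0 : z ≠ 0 := by rintro rfl; exact h0 hz
    exact hzs (resolvent_block_of_mem hPP hPT hz0 (spectrum.notMem_iff.1 (hiso z hz hne))).1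
  have hsph : Metric.sphere μ ρ ⊆ resolventSet ℂ T := by
    intro z hz
    refine spectrum.notMem_iff.1 (hiso z (Metric.sphere_subset_closedBall hz) ?_)
    rintro rfl
    rw [Metric.mem_sphere, dist_self] at hz; linarith
  have hfr := isFiniteRank_rieszProjection hTc hρ0 hsph h0
  rw [Set.indicator_of_mem (show μ ∈ {μ | IsDiscreteEigenvalue T μ} from ⟨hμT, ρ, hρ0, hiso, hfr⟩),
    algebraicMultiplicity_eq hρ0 hiso, algebraicMultiplicity_eq hρ0 hisoP,
    rieszProjection_block hPP hPT hρ0 hsph h0]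
  gcongr
  exact finrank_range_mul_mul_le hfr

end Compact

section Growth

lemma hasFPowerSeriesOnBall_of_hasSum {a : ℕ → ℂ} {g : ℂ → ℂ} {R : ℝ} (hR : 0 < R)
    (h : ∀ z ∈ Metric.ball (0 : ℂ) R, HasSum (fun k => z ^ k * a k) (g z)) :
    HasFPowerSeriesOnBall g (FormalMultilinearSeries.ofScalars ℂ a) 0 (ENNReal.ofReal R) where
  r_le := by
    refine ENNReal.le_of_forall_nnreal_lt fun s hs => ?_
    refine FormalMultilinearSeries.le_radius_of_summable _ ?_
    have hsR : (s : ℝ) < R := by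
      rw [← ENNReal.ofReal_coe_nnreal] at hs; exact (ENNReal.ofReal_lt_ofReal_iff hR).1 hs
    have := (h (s : ℝ) (by simpa using hsR)).summable.norm
    refine this.congr fun k => ?_
    rw [FormalMultilinearSeries.ofScalars_norm, norm_mul, norm_pow, mul_comm]
    simp
  r_pos := by simpa using hR
  hasSum := by
    intro z hz
    rw [Metric.eball_ofReal] at hz
    simpa [FormalMultilinearSeries.ofScalars_apply_eq, mul_comm] using h z hz

lemma norm_coeff_le_of_hasSum {a : ℕ → ℂ} {g : ℂ → ℂ} {R ρ C : ℝ} (hρ : 0 < ρ) (hρR : ρ < R)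
    (h : ∀ z ∈ Metric.ball (0 : ℂ) R, HasSum (fun k => z ^ k * a k) (g z))
    (hC : ∀ z ∈ Metric.sphere (0 : ℂ) ρ, ‖g z‖ ≤ C) (k : ℕ) : ‖a k‖ ≤ C / ρ ^ k := by
  have hg := hasFPowerSeriesOnBall_of_hasSum (hρ.trans hρR) h
  have hd : DifferentiableOn ℂ g (Metric.ball 0 R) := by
    simpa [Metric.eball_ofReal] using hg.differentiableOn
  have e := hg.hasFPowerSeriesAt.eq_formalMultilinearSeries hg.analyticAt.hasFPowerSeriesAt
  have e' : a k = iteratedDeriv k g 0 / k.factorial :=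
    congrFun (FormalMultilinearSeries.ofScalars_series_injective ℂ ℂ e) k
  have hb := Complex.norm_iteratedDeriv_le_of_forall_mem_sphere_norm_le k hρ
    ((hd.mono (Metric.closedBall_subset_ball hρR)).diffContOnCl_ball subset_rfl) hC
  rw [e', norm_div, Complex.norm_natCast, div_le_iff₀ (by positivity)]
  calc _ ≤ _ := hb
    _ = _ := by ring

lemma differentiable_prod_one_sub_mul (S : Multiset ℂ) :
    Differentiable ℂ fun z : ℂ => (S.map fun l => 1 - z * l).prod := by
  induction S using Multiset.induction with
  | empty => simp
  | cons a S ih =>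
    simp only [Multiset.map_cons, Multiset.prod_cons]
    exact (show Differentiable ℂ fun z : ℂ => 1 - z * a by fun_prop).mul ih

lemma prod_map_weierstrassFactor (m : ℕ) (S : Multiset ℂ) (z : ℂ) :
    (S.map fun l => weierstrassFactor m (z * l)).prod = (S.map fun l => 1 - z * l).prod *
      Complex.exp (∑ k ∈ Finset.Icc 1 m, z ^ k * ((S.map fun l => l ^ k).sum / k)) := by
  simp only [weierstrassFactor]
  rw [Multiset.prod_map_mul]
  congr 1
  rw [← Function.comp_def Complex.exp, ← Multiset.map_map, ← Complex.exp_multiset_sum,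
    Multiset.sum_map_sum]
  congr 1
  refine Finset.sum_congr rfl fun k _ => ?_
  rw [Multiset.sum_map_div, mul_div_assoc', ← Multiset.sum_map_mul_left]
  simp_rw [mul_pow]

lemma hasSum_log_prod (m : ℕ) (W S : Multiset ℂ) {z : ℂ} (hS : ∀ l ∈ S, ‖z * l‖ < 1) :
    HasSum (fun k : ℕ => z ^ k * ((if k ∈ Finset.Icc 1 m then (W.map fun l => l ^ k).sum / k else 0)
        - (S.map fun l => l ^ k).sum / k))
      ((∑ k ∈ Finset.Icc 1 m, z ^ k * ((W.map fun l => l ^ k).sum / k)) +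
        (S.map fun l => Complex.log (1 - z * l)).sum) := by
  simp_rw [mul_sub, sub_eq_add_neg (_ * _)]
  refine HasSum.add ?_ ?_
  · have := hasSum_sum_of_ne_finset_zero (L := SummationFilter.unconditional ℕ) (s := Finset.Icc 1 m)
      (f := fun k : ℕ => z ^ k *
        (if k ∈ Finset.Icc 1 m then (W.map fun l => l ^ k).sum / (k : ℂ) else 0))
      (fun k hk => by simp only [if_neg hk, mul_zero])
    convert this using 1
    exact Finset.sum_congr rfl fun k hk => by rw [if_pos hk]
  · induction S using Multiset.induction with
    | empty => simp
    | cons a S ih =>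
      have h1 := (Complex.hasSum_taylorSeries_neg_log (hS a (by simp))).neg
      rw [neg_neg] at h1
      have h2 := h1.add (ih fun l hl => hS l (Multiset.mem_cons_of_mem hl))
      simp only [Multiset.map_cons, Multiset.sum_cons]
      refine h2.congr_fun ?_ 
      intro k
      simp only [mul_pow]; ring

lemma one_le_norm_prod_of_forall {B : Multiset ℂ} (f : ℂ → ℂ) (h : ∀ l ∈ B, 1 ≤ ‖f l‖) :
    1 ≤ ‖(B.map f).prod‖ := by
  induction B using Multiset.induction with
  | empty => simp
  | cons b B ih =>
    simp only [Multiset.map_cons, Multiset.prod_cons, norm_mul]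
    exact one_le_mul_of_one_le_of_one_le (h b (by simp))
      (ih fun l hl => h l (Multiset.mem_cons_of_mem hl))

lemma exp_log_prod (m : ℕ) (W S : Multiset ℂ) {z : ℂ} (hS : ∀ l ∈ S, ‖z * l‖ < 1) :
    Complex.exp ((∑ k ∈ Finset.Icc 1 m, z ^ k * ((W.map fun l => l ^ k).sum / k)) +
        (S.map fun l => Complex.log (1 - z * l)).sum) = (S.map fun l => 1 - z * l).prod *
      Complex.exp (∑ k ∈ Finset.Icc 1 m, z ^ k * ((W.map fun l => l ^ k).sum / k)) := by
  rw [Complex.exp_add, mul_comm, Complex.exp_multiset_sum, Multiset.map_map]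
  congr 2
  refine Multiset.map_congr rfl fun l hl => Complex.exp_log fun h => ?_
  have := hS l hl
  rw [← sub_eq_zero.1 h, norm_one] at this
  exact this.false

/-- A Weierstrass product over small numbers is controlled by the growth of a product with
additional large numbers. -/
lemma norm_prod_weierstrassFactor_le (m : ℕ) {B S : Multiset ℂ} {r M : ℝ} (hr : 0 < r)
    (hr' : r ≤ 1 / 8) (hM : 0 < M) (hB : ∀ l ∈ B, r ≤ ‖l‖) (hS : ∀ l ∈ S, ‖l‖ < 2 * r)
    (hbd : ∀ z : ℂ, ‖z‖ = 2 / r →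
      ‖((B + S).map fun l => weierstrassFactor m (z * l)).prod‖ ≤ Real.exp M) :
    ‖(S.map fun l => weierstrassFactor m l).prod‖ ≤ Real.exp (4 * M * (4 * r) ^ (m + 1)) := by
  set W := B + S with hW
  let h : ℂ → ℂ := fun z => (S.map fun l => 1 - z * l).prod *
      Complex.exp (∑ k ∈ Finset.Icc 1 m, z ^ k * ((W.map fun l => l ^ k).sum / k))
  let g : ℂ → ℂ := fun z => (∑ k ∈ Finset.Icc 1 m, z ^ k * ((W.map fun l => l ^ k).sum / k)) +
        (S.map fun l => Complex.log (1 - z * l)).sum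
  let a : ℕ → ℂ := fun k => (if k ∈ Finset.Icc 1 m then (W.map fun l => l ^ k).sum / k else 0)
        - (S.map fun l => l ^ k).sum / k
  have hh : Differentiable ℂ h := (differentiable_prod_one_sub_mul S).mul (by fun_prop)
  have hfr : ∀ z ∈ Metric.sphere (0 : ℂ) (2 / r), ‖h z‖ ≤ Real.exp M := by
    intro z hz
    have hz' : ‖z‖ = 2 / r := by simpa using hz
    have e := prod_map_weierstrassFactor m W z
    rw [hW, Multiset.map_add (fun l => 1 - z * l), Multiset.prod_add, mul_assoc, ← hW] at e
    have h1 : 1 ≤ ‖(B.map fun l => 1 - z * l).prod‖ := by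
      have : ∀ l ∈ B, 1 ≤ ‖1 - z * l‖ := by
        intro l hl
        have h2 : 2 ≤ ‖z * l‖ := by
          rw [norm_mul, hz']
          calc (2 : ℝ) = 2 / r * r := by field_simp
            _ ≤ _ := by gcongr; exact hB l hl
        have := norm_sub_norm_le (z * l) 1
        rw [norm_sub_rev, norm_one] at this
        linarith
      exact one_le_norm_prod_of_forall _ this
    calc ‖h z‖ ≤ ‖(B.map fun l => 1 - z * l).prod‖ * ‖h z‖ :=
          le_mul_of_one_le_left (norm_nonneg _) h1
      _ = _ := by rw [← norm_mul]
      _ ≤ _ := by rw [← e]; exact hbd z hz'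
  have hle : ∀ z ∈ Metric.ball (0 : ℂ) (1 / (2 * r)), ‖h z‖ ≤ Real.exp M := by
    intro z hz
    refine Complex.norm_le_of_forall_mem_frontier_norm_le Metric.isBounded_ball hh.diffContOnCl
      (U := Metric.ball 0 (2 / r)) ?_ (subset_closure (Metric.ball_subset_ball ?_ hz))
    · rw [frontier_ball _ (by positivity)]; exact hfr
    · rw [div_le_div_iff₀ (by positivity) hr]; linarith
  have hsmall : ∀ z ∈ Metric.ball (0 : ℂ) (1 / (2 * r)), ∀ l ∈ S, ‖z * l‖ < 1 := by
    intro z hz l hl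
    rw [norm_mul]
    calc ‖z‖ * ‖l‖ < 1 / (2 * r) * (2 * r) := by
          refine mul_lt_mul'' (by simpa using hz) (hS l hl) (norm_nonneg _) (norm_nonneg _)
      _ = 1 := by field_simp
  have hsum : ∀ z ∈ Metric.ball (0 : ℂ) (1 / (2 * r)), HasSum (fun k => z ^ k * a k) (g z) :=
    fun z hz => hasSum_log_prod m W S (hsmall z hz)
  have hR : 0 < 1 / (2 * r) := by positivity
  have hd : DifferentiableOn ℂ g (Metric.ball 0 (1 / (2 * r))) := by
    simpa [Metric.eball_ofReal] using (hasFPowerSeriesOnBall_of_hasSum hR hsum).differentiableOn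
  have hre : Set.MapsTo g (Metric.ball 0 (1 / (2 * r))) {z | z.re ≤ M} := by
    intro z hz
    have := hle z hz
    have e : Complex.exp (g z) = h z := exp_log_prod m W S (hsmall z hz)
    rw [← e, Complex.norm_exp] at this
    exact Real.exp_le_exp.1 this
  have hg0 : g 0 = 0 := by
    simp only [g, zero_mul, sub_zero, Complex.log_one]
    rw [Finset.sum_eq_zero, zero_add]
    · simp
    · intro k hk
      rw [zero_pow (by have := (Finset.mem_Icc.1 hk).1; omega), zero_mul]
  have hρ : 0 < 1 / (4 * r) := by positivity
  have hρR : 1 / (4 * r) < 1 / (2 * r) := by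
    rw [div_lt_div_iff₀ (by positivity) (by positivity)]; linarith
  have hgC : ∀ z ∈ Metric.sphere (0 : ℂ) (1 / (4 * r)), ‖g z‖ ≤ 2 * M := by
    intro z hz
    have hz' : ‖z‖ = 1 / (4 * r) := by simpa using hz
    have := Complex.borelCaratheodory_zero hM hd hre hR (z := z) (by simpa [hz'] using hρR) hg0
    rw [hz'] at this
    refine this.trans_eq ?_
    field_simp
    norm_num
  have ha : ∀ k, ‖a k‖ ≤ 2 * M * (4 * r) ^ k := by
    intro k
    refine (norm_coeff_le_of_hasSum hρ hρR hsum hgC k).trans_eq ?_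
    rw [one_div, inv_pow, div_inv_eq_mul]
  have h1S : ∀ l ∈ S, ‖(1 : ℂ) * l‖ < 1 := by
    intro l hl; rw [one_mul]; linarith [hS l hl]
  have hs := hasSum_log_prod m S S h1S
  set s := (∑ k ∈ Finset.Icc 1 m, (1 : ℂ) ^ k * ((S.map fun l => l ^ k).sum / k)) +
        (S.map fun l => Complex.log (1 - 1 * l)).sum
  have hes : Complex.exp s = (S.map fun l => weierstrassFactor m l).prod := by
    rw [exp_log_prod m S S h1S, ← prod_map_weierstrassFactor]; simp
  rw [← hasSum_nat_add_iff' (m + 1), Finset.sum_eq_zero, sub_zero] at hs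
  swap
  · intro k hk
    rcases Nat.eq_zero_or_pos k with rfl | hk0
    · simp
    · rw [if_pos (by simp at hk ⊢; omega), sub_self, mul_zero]
  have h4r : 4 * r < 1 := by linarith
  have hgeo := (hasSum_geometric_of_lt_one (by positivity) h4r).mul_left
    (2 * M * (4 * r) ^ (m + 1))
  have hns : ‖s‖ ≤ 2 * M * (4 * r) ^ (m + 1) * (1 - 4 * r)⁻¹ := by
    rw [← hs.tsum_eq]
    refine tsum_of_norm_bounded hgeo fun k => ?_
    have := ha (k + (m + 1))
    simp only [a] at this
    rw [if_neg (by simp; omega)] at this ⊢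
    rw [one_pow, one_mul]
    refine this.trans_eq ?_
    rw [pow_add]; ring
  rw [← hes, Complex.norm_exp]
  refine Real.exp_le_exp.2 ((Complex.re_le_norm s).trans (hns.trans ?_))
  have : (1 - 4 * r)⁻¹ ≤ 2 := by
    rw [inv_le_comm₀ (by linarith) (by norm_num)]; linarith
  calc _ ≤ 2 * M * (4 * r) ^ (m + 1) * 2 := by gcongr
    _ = _ := by ring

end Growth

section TraceEstimates

lemma norm_trace_pow_sub_pow_mul_le {V ι : Type*} [NormedAddCommGroup V] [NormedSpace ℂ V]
    [FiniteDimensional ℂ V] (s : Finset ι) (f : ι → V →ₗ[ℂ] ℂ) (x : ι → V) {a b : Module.End ℂ V}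
    (hab : a - b = ∑ i ∈ s, (f i).smulRight (x i)) {φ : ι → ℝ}
    (hf : ∀ i ∈ s, ∀ v, ‖f i v‖ ≤ φ i * ‖v‖) (hφ : ∀ i ∈ s, 0 ≤ φ i) {M : ℝ}
    (hν : ∑ i ∈ s, φ i * ‖x i‖ ≤ M) (ha : ∀ v, ‖a v‖ ≤ M * ‖v‖) (hb : ∀ v, ‖b v‖ ≤ M * ‖v‖)
    (k : ℕ) {c : Module.End ℂ V} {C : ℝ} (hC : 0 ≤ C) (hc : ∀ v, ‖c v‖ ≤ C * ‖v‖) :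
    ‖LinearMap.trace ℂ V ((a ^ k - b ^ k) * c)‖ ≤ k * M ^ k * C := by
  have hM : 0 ≤ M := (Finset.sum_nonneg fun i hi => mul_nonneg (hφ i hi) (norm_nonneg _)).trans hν
  have hak : ∀ (k : ℕ) (v : V), ‖(a ^ k) v‖ ≤ M ^ k * ‖v‖ := by
    intro k
    induction k with
    | zero => intro v; simp
    | succ k ih =>
      intro v
      rw [pow_succ', Module.End.mul_apply]
      calc _ ≤ M * ‖(a ^ k) v‖ := ha _
        _ ≤ M * (M ^ k * ‖v‖) := by gcongr; exact ih v
        _ = _ := by ring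
  induction k generalizing c C with
  | zero => simp
  | succ k ih =>
    have e : (a ^ (k + 1) - b ^ (k + 1)) * c = a ^ k * (a - b) * c + (a ^ k - b ^ k) * (b * c) := by
      rw [pow_succ, pow_succ]; noncomm_ring
    have h1 : LinearMap.trace ℂ V (a ^ k * (a - b) * c) = ∑ i ∈ s, f i (c ((a ^ k) (x i))) := by
      rw [mul_assoc, LinearMap.trace_mul_comm, hab, mul_assoc, Finset.sum_mul, map_sum]
      refine Finset.sum_congr rfl fun i _ => ?_
      have : (f i).smulRight (x i) * (c * a ^ k) = (f i ∘ₗ (c * a ^ k)).smulRight (x i) := by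
        ext v; simp
      rw [this, LinearMap.trace_smulRight]; rfl
    have h2 : ‖LinearMap.trace ℂ V (a ^ k * (a - b) * c)‖ ≤ M * (C * M ^ k) := by
      rw [h1]
      calc _ ≤ ∑ i ∈ s, ‖f i (c ((a ^ k) (x i)))‖ := norm_sum_le _ _
        _ ≤ ∑ i ∈ s, φ i * ‖x i‖ * (C * M ^ k) := by
          refine Finset.sum_le_sum fun i hi => ?_
          calc _ ≤ φ i * ‖c ((a ^ k) (x i))‖ := hf i hi _
            _ ≤ φ i * (C * (M ^ k * ‖x i‖)) := by
              have := hφ i hi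
              gcongr
              refine (hc _).trans ?_
              gcongr
              exact hak k _
            _ = _ := by ring
        _ ≤ _ := by rw [← Finset.sum_mul]; gcongr
    have h3 := ih (c := b * c) (C := M * C) (by positivity) fun v => by
      calc _ ≤ M * ‖c v‖ := hb _
        _ ≤ M * (C * ‖v‖) := by gcongr; exact hc v
        _ = _ := by ring
    rw [e, map_add]
    refine (norm_add_le _ _).trans ((add_le_add h2 h3).trans_eq ?_)
    push_cast; ring

omit [CompleteSpace X] in
lemma norm_trOn_pow_sub_le {ι : Type*} (s : Finset ι) (f : ι → X →L[ℂ] ℂ) (x : ι → X)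
    {S T : X →L[ℂ] X} (hT : IsFiniteRank T)
    (hST : S - T = ∑ i ∈ s, (f i).smulRight (x i)) {M : ℝ}
    (hν : ∑ i ∈ s, ‖f i‖ * ‖x i‖ ≤ M) (hSM : ‖S‖ ≤ M) (hTM : ‖T‖ ≤ M) {k : ℕ} (hk : 1 ≤ k) :
    ‖trOn (S ^ k) - trOn (T ^ k)‖ ≤ k * M ^ k := by
  have hfd : FiniteDimensional ℂ (LinearMap.range (T : X →ₗ[ℂ] X)) := hT
  set V := LinearMap.range (T : X →ₗ[ℂ] X) ⊔ Submodule.span ℂ (x '' s) with hV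
  have hfd' : FiniteDimensional ℂ (Submodule.span ℂ (x '' s)) :=
    FiniteDimensional.span_of_finite ℂ (s.finite_toSet.image x)
  have hfdV : FiniteDimensional ℂ V := by rw [hV]; infer_instance
  have hxV : ∀ i ∈ s, x i ∈ V := fun i hi =>
    Submodule.mem_sup_right (Submodule.subset_span ⟨i, hi, rfl⟩)
  have hTV : ∀ y, T y ∈ V := fun y => Submodule.mem_sup_left ⟨y, rfl⟩
  have hSV : ∀ y, S y ∈ V := by
    intro y
    rw [← sub_add_cancel S T, hST, add_apply, sum_apply]
    exact V.add_mem (V.sum_mem fun i hi => V.smul_mem _ (hxV i hi)) (hTV y)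
  rw [trOn_eq_trace V _ (pow_apply_mem V hSV hk), trOn_eq_trace V _ (pow_apply_mem V hTV hk),
    restrictTo_pow V S hSV, restrictTo_pow V T hTV, ← map_sub]
  have key := norm_trace_pow_sub_pow_mul_le (V := V) s.attach
    (fun i => (f i : X →ₗ[ℂ] ℂ) ∘ₗ V.subtype) (fun i => ⟨x i, hxV i i.2⟩)
    (a := restrictTo V S hSV) (b := restrictTo V T hTV) ?_ (φ := fun i => ‖f i‖)
    (fun i _ v => (f i).le_opNorm v) (fun i _ => norm_nonneg _) (M := M)
    ((Finset.sum_attach s fun i => ‖f i‖ * ‖x i‖).trans_le hν)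
    (fun v => (S.le_opNorm v).trans (mul_le_mul_of_nonneg_right hSM (norm_nonneg _)))
    (fun v => (T.le_opNorm v).trans (mul_le_mul_of_nonneg_right hTM (norm_nonneg _)))
    k (c := 1) zero_le_one (fun v => by simp)
  · simpa using key
  · ext v
    have := DFunLike.congr_fun hST (v : X)
    rw [sum_apply] at this
    rw [LinearMap.sum_apply, AddSubmonoidClass.coe_finsetSum]
    simp only [ContinuousLinearMap.smulRight_apply] at this
    rw [← Finset.sum_attach] at this
    exact this

omit [CompleteSpace X] in
lemma exists_eq_sum_smulRight {F : X →L[ℂ] X} (hF : IsFiniteRank F) :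
    ∃ (n : ℕ) (f : Fin n → X →L[ℂ] ℂ) (x : Fin n → X), F = ∑ i, (f i).smulRight (x i) := by
  have hfd : FiniteDimensional ℂ (LinearMap.range (F : X →ₗ[ℂ] X)) := hF
  let V := LinearMap.range (F : X →ₗ[ℂ] X)
  let b := Module.finBasis ℂ V
  let F' : X →L[ℂ] V := F.codRestrict V fun x => LinearMap.mem_range_self _ x
  refine ⟨_, fun i => (LinearMap.toContinuousLinearMap (b.coord i)).comp F', fun i => b i, ?_⟩
  ext v
  have := congrArg (Subtype.val) (b.sum_repr (F' v))
  rw [AddSubmonoidClass.coe_finsetSum] at this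
  rw [sum_apply]
  exact this.symm

omit [CompleteSpace X] in
lemma isFiniteRank_sum_smulRight {ι : Type*} (s : Finset ι) (f : ι → X →L[ℂ] ℂ) (x : ι → X) :
    IsFiniteRank (∑ i ∈ s, (f i).smulRight (x i)) := by
  have hfd' : FiniteDimensional ℂ (Submodule.span ℂ (x '' s)) :=
    FiniteDimensional.span_of_finite ℂ (s.finite_toSet.image x)
  refine isFiniteRank_of_forall_mem (Submodule.span ℂ (x '' s)) fun y => ?_
  rw [sum_apply]
  exact Submodule.sum_mem _ fun i hi => Submodule.smul_mem _ _ (Submodule.subset_span ⟨i, hi, rfl⟩)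

omit [CompleteSpace X] in
lemma norm_detOneSub_add_smul_sum_le {n : ℕ} (f : Fin n → X →L[ℂ] ℂ) (x : Fin n → X)
    {G : X →L[ℂ] X} (hG : IsFiniteRank G) (w : ℂ) {B : ℝ}
    (hB : ∀ S : Finset (Fin n), ‖detOneSub (G + ∑ i ∈ S, (f i).smulRight (x i))‖ ≤ B) :
    ‖detOneSub (G + w • ∑ i, (f i).smulRight (x i))‖ ≤ (1 + 2 * ‖w‖) ^ n * B := by
  have hfd : FiniteDimensional ℂ (LinearMap.range (G : X →ₗ[ℂ] X)) := hG
  set V := LinearMap.range (G : X →ₗ[ℂ] X) ⊔ Submodule.span ℂ (Set.range x) with hV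
  have hfd' : FiniteDimensional ℂ (Submodule.span ℂ (Set.range x)) :=
    FiniteDimensional.span_of_finite ℂ (Set.finite_range x)
  have hfdV : FiniteDimensional ℂ V := by rw [hV]; infer_instance
  have hxV : ∀ i, x i ∈ V := fun i => Submodule.mem_sup_right (Submodule.subset_span ⟨i, rfl⟩)
  have hGV : ∀ y, G y ∈ V := fun y => Submodule.mem_sup_left ⟨y, rfl⟩
  have hSV : ∀ (u : ℂ) (S : Finset (Fin n)) (y : X),
      (G + u • ∑ i ∈ S, (f i).smulRight (x i)) y ∈ V := by
    intro u S y
    rw [add_apply, smul_apply,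
      sum_apply]
    exact V.add_mem (hGV y) (V.smul_mem u (V.sum_mem fun i _ => V.smul_mem _ (hxV i)))
  have e : ∀ (u : ℂ) (S : Finset (Fin n)),
      1 - restrictTo V (G + u • ∑ i ∈ S, (f i).smulRight (x i)) (hSV u S) =
      (1 - restrictTo V G hGV) - u • ∑ i ∈ S,
        ((f i : X →ₗ[ℂ] ℂ) ∘ₗ V.subtype).smulRight (⟨x i, hxV i⟩ : V) := by
    intro u S
    rw [sub_sub]
    congr 1
    ext v
    rw [coe_restrictTo_apply, add_apply, smul_apply,
      sum_apply, LinearMap.add_apply, LinearMap.smul_apply,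
      LinearMap.sum_apply, Submodule.coe_add, Submodule.coe_smul, AddSubmonoidClass.coe_finsetSum]
    rfl
  have key := norm_det_sub_smul_sum_le Finset.univ
    (fun i => (f i : X →ₗ[ℂ] ℂ) ∘ₗ V.subtype) (fun i => (⟨x i, hxV i⟩ : V)) w B
    (1 - restrictTo V G hGV) ?_
  · rw [detOneSub_eq_det V _ (hSV w Finset.univ), e]
    simpa using key
  · intro S _
    have h1 := hB S
    have h2 := e 1 S
    simp only [one_smul] at h2
    rw [← h2]
    rwa [detOneSub_eq_det V _ (by simpa using hSV 1 S)] at h1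

omit [CompleteSpace X] in
lemma norm_detp_add_smul_sum_le (p : ℝ) {n : ℕ} (f : Fin n → X →L[ℂ] ℂ) (x : Fin n → X)
    {G : X →L[ℂ] X} (hG : IsFiniteRank G) (w : ℂ) {B M : ℝ} (hM : 1 ≤ M)
    (hν : (1 + ‖w‖) * ∑ i, ‖f i‖ * ‖x i‖ ≤ M)
    (hGM : ‖G + w • ∑ i, (f i).smulRight (x i)‖ ≤ M)
    (hSM : ∀ S : Finset (Fin n), ‖G + ∑ i ∈ S, (f i).smulRight (x i)‖ ≤ M)
    (hSB : ∀ S : Finset (Fin n), ‖detp p (G + ∑ i ∈ S, (f i).smulRight (x i))‖ ≤ B) :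
    ‖detp p (G + w • ∑ i, (f i).smulRight (x i))‖ ≤
      (1 + 2 * ‖w‖) ^ n * (B * Real.exp ((⌈p⌉₊ - 1 : ℕ) * M ^ (⌈p⌉₊ - 1))) := by
  set m := ⌈p⌉₊ - 1 with hm
  set F := G + w • ∑ i, (f i).smulRight (x i) with hF
  let t : (X →L[ℂ] X) → ℂ := fun T => ∑ k ∈ Finset.Icc 1 m, trOn (T ^ k) / (k : ℂ)
  have hdet : ∀ T : X →L[ℂ] X, detp p T = detOneSub T * Complex.exp (t T) := fun T => rfl
  have ht : ∀ S : Finset (Fin n),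
      ‖t F - t (G + ∑ i ∈ S, (f i).smulRight (x i))‖ ≤ m * M ^ m := by
    intro S
    classical
    have hdiff : F - (G + ∑ i ∈ S, (f i).smulRight (x i)) =
        ∑ i, ((w - if i ∈ S then 1 else 0) • f i).smulRight (x i) := by
      have h1 : ∑ i ∈ S, (f i).smulRight (x i) =
          ∑ i, (if i ∈ S then (1 : ℂ) else 0) • (f i).smulRight (x i) := by
        simp [ite_smul, Finset.sum_ite_mem]
      rw [hF, h1, add_sub_add_left_eq_sub, Finset.smul_sum, ← Finset.sum_sub_distrib]
      refine Finset.sum_congr rfl fun i _ => ?_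
      ext v
      by_cases hi : i ∈ S <;> simp [hi, sub_smul, mul_smul]
    have hle : ∑ i, ‖(w - if i ∈ S then 1 else 0) • f i‖ * ‖x i‖ ≤ M := by
      refine le_trans ?_ hν
      rw [Finset.mul_sum]
      refine Finset.sum_le_sum fun i _ => ?_
      rw [norm_smul, mul_assoc]
      gcongr
      refine (norm_sub_le _ _).trans ?_
      rw [add_comm]
      gcongr
      split_ifs <;> simp
    simp only [t]
    rw [← Finset.sum_sub_distrib]
    calc _ ≤ ∑ k ∈ Finset.Icc 1 m, M ^ m := by
          refine norm_sum_le_of_le _ fun k hk => ?_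
          have hk1 := (Finset.mem_Icc.1 hk).1
          have hk0 : (0 : ℝ) < k := by exact_mod_cast hk1
          rw [← sub_div, norm_div, Complex.norm_natCast, div_le_iff₀ hk0]
          refine (norm_trOn_pow_sub_le Finset.univ _ x
            (hG.add (isFiniteRank_sum_smulRight S f x)) hdiff hle hGM (hSM S) hk1).trans ?_
          rw [mul_comm]
          gcongr
          exact (Finset.mem_Icc.1 hk).2
      _ = _ := by simp
  have hb := norm_detOneSub_add_smul_sum_le f x hG w
    (B := B * Real.exp (m * M ^ m) * Real.exp (-(t F).re)) fun S => by
      set T := G + ∑ i ∈ S, (f i).smulRight (x i)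
      have h1 : detOneSub T = detp p T * Complex.exp (-t T) := by
        rw [hdet, mul_assoc, ← Complex.exp_add, add_neg_cancel, Complex.exp_zero, mul_one]
      rw [h1, norm_mul, Complex.norm_exp, mul_assoc, ← Real.exp_add]
      refine mul_le_mul (hSB S) (Real.exp_le_exp.2 ?_) (Real.exp_pos _).le
        ((norm_nonneg _).trans (hSB S))
      have h2 := (Complex.re_le_norm _).trans (ht S)
      rw [Complex.sub_re] at h2
      rw [Complex.neg_re]
      linarith
  rw [hdet, norm_mul, Complex.norm_exp]
  calc _ ≤ _ := mul_le_mul_of_nonneg_right hb (Real.exp_pos _).le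
    _ = (1 + 2 * ‖w‖) ^ n * (B * Real.exp (m * M ^ m)) *
        (Real.exp (-(t F).re) * Real.exp (t F).re) := by ring
    _ = _ := by rw [← Real.exp_add, neg_add_cancel, Real.exp_zero, mul_one]

end TraceEstimates

section IdealGrowth

namespace LpIdeal

variable {p : ℝ} (I : LpIdeal p X)

lemma norm_detp_le (hp : 0 < p) {Γ : ℝ} (hΓ : 0 < Γ)
    (hΓb : ∀ F : X →L[ℂ] X, IsFiniteRank F → ‖detp p F‖ ≤ Real.exp (Γ * (eigSum p F).toReal))
    {F : X →L[ℂ] X} (hF : IsFiniteRank F) {t : ℝ} (ht : I.norm' F ≤ t) :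
    ‖detp p F‖ ≤ Real.exp (Γ * I.γ ^ p * t ^ p) := by
  have hFI := I.finiteRank_mem F hF
  have h0 := I.norm'_nonneg F hFI
  refine (hΓb F hF).trans (Real.exp_le_exp.2 ?_)
  rw [mul_assoc, ← Real.mul_rpow I.γ_nonneg (h0.trans ht)]
  gcongr
  have hγ := I.γ_nonneg
  refine ENNReal.toReal_le_of_le_ofReal
    (Real.rpow_nonneg (mul_nonneg hγ (h0.trans ht)) _) ((I.eig_le F hFI).trans ?_)
  gcongr

lemma norm'_neg {L : X →L[ℂ] X} (hL : L ∈ I.carrier) : I.norm' (-L) = I.norm' L := by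
  simpa using I.norm'_smul L hL (-1)

lemma neg_mem {L : X →L[ℂ] X} (hL : L ∈ I.carrier) : -L ∈ I.carrier := by
  simpa using I.smul_mem (-1) hL

lemma sub_mem {K L : X →L[ℂ] X} (hK : K ∈ I.carrier) (hL : L ∈ I.carrier) : K - L ∈ I.carrier := by
  rw [sub_eq_add_neg]; exact I.add_mem hK (I.neg_mem hL)

lemma norm'_sub_comm {K L : X →L[ℂ] X} (hK : K ∈ I.carrier) (hL : L ∈ I.carrier) :
    I.norm' (K - L) = I.norm' (L - K) := by
  rw [← I.norm'_neg (I.sub_mem hK hL), neg_sub]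

/-- The order of growth of `z ↦ det_p(1 - zF)` is of minimal type, uniformly for finite rank `F`
close to a given member of the ideal. -/
lemma exists_norm_detp_smul_le (hp : 0 < p) {Γ : ℝ} (hΓ : 0 < Γ)
    (hΓb : ∀ F : X →L[ℂ] X, IsFiniteRank F → ‖detp p F‖ ≤ Real.exp (Γ * (eigSum p F).toReal))
    {L : X →L[ℂ] X} (hL : L ∈ I.carrier) {δ : ℝ} (hδ : 0 < δ) :
    ∃ η > 0, ∃ R > 0, ∀ F : X →L[ℂ] X, IsFiniteRank F → I.norm' (F - L) < η →
      ∀ z : ℂ, R ≤ ‖z‖ → ‖detp p (z • F)‖ ≤ Real.exp (δ * ‖z‖ ^ p) := by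
  have hq : 0 < I.q := zero_lt_one.trans_le I.one_le_q
  have hγ := I.γ_nonneg
  set m := ⌈p⌉₊ - 1 with hm
  have hmp : (m : ℝ) < p := by
    have h1 := Nat.ceil_lt_add_one hp.le
    have h2 : 1 ≤ ⌈p⌉₊ := Nat.one_le_iff_ne_zero.2 (Nat.ceil_pos.2 hp).ne'
    rw [hm, Nat.cast_sub h2]; push_cast; linarith
  obtain ⟨η, hη, hηδ⟩ : ∃ η > 0, Γ * I.γ ^ p * (3 * I.q ^ 2 * η) ^ p ≤ δ / 4 := by
    have hc : Filter.Tendsto (fun η : ℝ => Γ * I.γ ^ p * (3 * I.q ^ 2 * η) ^ p)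
        (nhdsWithin 0 (Set.Ioi 0)) (nhds 0) := by
      have : ContinuousAt (fun η : ℝ => Γ * I.γ ^ p * (3 * I.q ^ 2 * η) ^ p) 0 :=
        continuousAt_const.mul ((continuousAt_const.mul continuousAt_id).rpow_const (Or.inr hp.le))
      have h2 := this.tendsto.mono_left (nhdsWithin_le_nhds (s := Set.Ioi 0))
      simpa [Real.zero_rpow hp.ne'] using h2
    obtain ⟨η, h1, h2⟩ := ((hc.eventually (ge_mem_nhds (show (0 : ℝ) < δ / 4 by positivity))).and
      self_mem_nhdsWithin).exists
    exact ⟨η, h2, h1⟩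
  obtain ⟨F₀, hF₀, hF₀L⟩ := I.dense_finiteRank L hL η hη
  have hF₀I := I.finiteRank_mem F₀ hF₀
  obtain ⟨n, f, x, hfx⟩ := exists_eq_sum_smulRight hF₀
  set ν := ∑ i, ‖f i‖ * ‖x i‖ with hν
  have hν0 : 0 ≤ ν := by positivity
  have hfin : ∀ S : Finset (Fin n), IsFiniteRank (∑ i ∈ S, (f i).smulRight (x i)) :=
    fun S => isFiniteRank_sum_smulRight S f x
  have hSI := fun S => I.finiteRank_mem _ (hfin S)
  set b := ∑ S : Finset (Fin n), I.norm' (∑ i ∈ S, (f i).smulRight (x i)) with hb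
  have hSb : ∀ S : Finset (Fin n), I.norm' (∑ i ∈ S, (f i).smulRight (x i)) ≤ b := fun S =>
    Finset.single_le_sum (f := fun S : Finset (Fin n) => I.norm' (∑ i ∈ S, (f i).smulRight (x i)))
      (fun S _ => I.norm'_nonneg _ (hSI S)) (Finset.mem_univ S)
  have hSν : ∀ S : Finset (Fin n), ‖∑ i ∈ S, (f i).smulRight (x i)‖ ≤ ν := by
    intro S
    refine (norm_sum_le _ _).trans ?_
    simp only [ContinuousLinearMap.norm_smulRight_apply]
    exact Finset.sum_le_sum_of_subset_of_nonneg (Finset.subset_univ _) fun i _ _ => by positivity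
  set C := 1 + 2 * I.q * η + ν with hC
  have hC1 : 1 ≤ C := by rw [hC]; have : 0 ≤ 2 * I.q * η := by positivity
                         linarith
  have hgrow : ∀ᶠ t : ℝ in Filter.atTop, n * Real.log (3 * t) ≤ δ / 4 * t ^ p ∧
      m * (C * (2 * t)) ^ m ≤ δ / 4 * t ^ p := by
    refine Filter.Eventually.and ?_ ?_
    · have h1 := (isLittleO_log_rpow_atTop hp).bound (c := δ / 8 / (n + 1)) (by positivity)
      have h2 : ∀ᶠ t : ℝ in Filter.atTop, n * Real.log 3 ≤ δ / 8 * t ^ p :=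
        ((tendsto_rpow_atTop hp).const_mul_atTop (by positivity)).eventually_ge_atTop _
      filter_upwards [h1, h2, Filter.eventually_ge_atTop 1] with t h1 h2 ht
      have ht0 : 0 < t := by linarith
      have hlogt : Real.log t ≤ δ / 8 / (n + 1) * t ^ p := by
        rw [Real.norm_of_nonneg (Real.log_nonneg ht), Real.norm_of_nonneg (by positivity)] at h1
        exact h1
      have h3 : n * Real.log t ≤ δ / 8 * t ^ p := by
        calc n * Real.log t ≤ (n + 1 : ℝ) * (δ / 8 / (n + 1) * t ^ p) := by
              have := Real.log_nonneg ht
              gcongr; linarith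
          _ = _ := by field_simp
      rw [Real.log_mul (by norm_num) ht0.ne']
      linarith
    · have h1 : ∀ᶠ t : ℝ in Filter.atTop, m * (C * 2) ^ m ≤ δ / 4 * t ^ (p - m) :=
        ((tendsto_rpow_atTop (sub_pos.2 hmp)).const_mul_atTop
          (by positivity)).eventually_ge_atTop _
      filter_upwards [h1, Filter.eventually_ge_atTop 1] with t h1 ht
      have ht0 : 0 < t := by linarith
      have h2 : t ^ p = t ^ (p - m) * t ^ m := by
        rw [← Real.rpow_natCast t m, ← Real.rpow_add ht0, sub_add_cancel]
      calc m * (C * (2 * t)) ^ m = m * (C * 2) ^ m * t ^ m := by rw [← mul_assoc, mul_pow]; ring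
        _ ≤ δ / 4 * t ^ (p - m) * t ^ m := by gcongr
        _ = _ := by rw [h2, mul_assoc]
  obtain ⟨R₁, hR₁⟩ := Filter.eventually_atTop.1 hgrow
  refine ⟨η, hη, max (max R₁ 1) (b / (I.q * η)), by positivity, fun F hF hFL z hz => ?_⟩
  have hz1 : 1 ≤ ‖z‖ := (le_max_right _ _).trans ((le_max_left _ _).trans hz)
  obtain ⟨hlog, hpow⟩ := hR₁ ‖z‖ ((le_max_left _ _).trans ((le_max_left _ _).trans hz))
  have hbz : b ≤ I.q * η * ‖z‖ := by
    have := (le_max_right _ _).trans hz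
    rwa [div_le_iff₀ (by positivity), mul_comm] at this
  set G := F - F₀ with hG
  have hGfin : IsFiniteRank G := by
    rw [hG, sub_eq_add_neg, ← neg_one_smul ℂ F₀]; exact hF.add (hF₀.smul _)
  have hGI := I.finiteRank_mem G hGfin
  have hFI := I.finiteRank_mem F hF
  have hGn : I.norm' G ≤ 2 * I.q * η := by
    have := I.norm'_add_le _ (I.sub_mem hFI hL) _ (I.sub_mem hL hF₀I)
    rw [sub_add_sub_cancel] at this
    refine this.trans ?_
    calc _ ≤ I.q * (η + η) := by gcongr
      _ = _ := by ring
  have hzG : IsFiniteRank (z • G) := hGfin.smul z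
  have hzGn : I.norm' (z • G) ≤ ‖z‖ * (2 * I.q * η) := by
    rw [I.norm'_smul G hGI]; gcongr
  have hzGop : ‖z • G‖ ≤ ‖z‖ * (2 * I.q * η) := (I.opNorm_le _ (I.smul_mem z hGI)).trans hzGn
  set M := C * (2 * ‖z‖) with hM
  have hνz : ν ≤ ‖z‖ * ν := le_mul_of_one_le_left hν0 hz1
  have hM1 : 1 ≤ M := one_le_mul_of_one_le_of_one_le hC1 (by linarith)
  have hqη : 0 ≤ ‖z‖ * (I.q * η) := by positivity
  have hSM : ∀ S : Finset (Fin n), ‖z • G + ∑ i ∈ S, (f i).smulRight (x i)‖ ≤ M := by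
    intro S
    refine (norm_add_le _ _).trans ((add_le_add hzGop (hSν S)).trans ?_)
    rw [hM, hC]; nlinarith
  have e : z • F = z • G + z • ∑ i, (f i).smulRight (x i) := by
    rw [← hfx, hG, ← smul_add, sub_add_cancel]
  have hFM : ‖z • G + z • ∑ i, (f i).smulRight (x i)‖ ≤ M := by
    refine (norm_add_le _ _).trans ((add_le_add hzGop
      (norm_smul z (∑ i, (f i).smulRight (x i))).le).trans ?_)
    refine (add_le_add le_rfl (mul_le_mul_of_nonneg_left (hSν _) (norm_nonneg _))).trans ?_
    rw [hM, hC]; nlinarith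
  have hSB : ∀ S : Finset (Fin n), ‖detp p (z • G + ∑ i ∈ S, (f i).smulRight (x i))‖ ≤
      Real.exp (δ / 4 * ‖z‖ ^ p) := by
    intro S
    have hle : I.norm' (z • G + ∑ i ∈ S, (f i).smulRight (x i)) ≤ 3 * I.q ^ 2 * η * ‖z‖ := by
      refine (I.norm'_add_le _ (I.smul_mem z hGI) _ (hSI S)).trans ?_
      calc _ ≤ I.q * (‖z‖ * (2 * I.q * η) + I.q * η * ‖z‖) := by
            gcongr
            exact (hSb S).trans hbz
        _ = _ := by ring
    refine (I.norm_detp_le hp hΓ hΓb (hzG.add (hfin S)) hle).trans (Real.exp_le_exp.2 ?_)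
    rw [Real.mul_rpow (by positivity) (norm_nonneg _), ← mul_assoc]
    gcongr
  rw [e]
  refine (norm_detp_add_smul_sum_le p f x hzG z hM1 ?_ hFM hSM hSB).trans ?_
  · rw [hM, hC]; nlinarith
  · have h1 : (1 + 2 * ‖z‖) ^ n ≤ Real.exp (δ / 4 * ‖z‖ ^ p) := by
      calc (1 + 2 * ‖z‖) ^ n ≤ (3 * ‖z‖) ^ n := by gcongr; linarith
        _ = Real.exp (n * Real.log (3 * ‖z‖)) := by
          rw [Real.exp_nat_mul, Real.exp_log (by positivity)]
        _ ≤ _ := Real.exp_le_exp.2 hlog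
    calc _ ≤ Real.exp (δ / 4 * ‖z‖ ^ p) * (Real.exp (δ / 4 * ‖z‖ ^ p) *
          Real.exp (δ / 4 * ‖z‖ ^ p)) := by gcongr
      _ = Real.exp (δ / 4 * ‖z‖ ^ p + (δ / 4 * ‖z‖ ^ p + δ / 4 * ‖z‖ ^ p)) := by
        rw [Real.exp_add, Real.exp_add]
      _ ≤ _ := by
        gcongr
        have : 0 ≤ δ * ‖z‖ ^ p := by positivity
        linarith

end LpIdeal

end IdealGrowth

section Splitting

omit [CompleteSpace X] in
lemma mem_spectrum_of_mem_roots (V : Submodule ℂ X) [FiniteDimensional ℂ V] {F : X →L[ℂ] X}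
    (h : ∀ x, F x ∈ V) {l : ℂ} (hl : l ∈ (restrictTo V F h).charpoly.roots) : l ∈ spectrum ℂ F := by
  have hev : (restrictTo V F h).HasEigenvalue l :=
    (Module.End.hasEigenvalue_iff_isRoot_charpoly _ _).2 (Polynomial.isRoot_of_mem_roots hl)
  obtain ⟨v, hv⟩ := hev.exists_hasEigenvector
  have hFv : F v = l • (v : X) := congrArg Subtype.val hv.apply_eq_smul
  intro hu
  obtain ⟨u, hu⟩ := hu
  have h0 : (u : X →L[ℂ] X) v = 0 := by
    rw [hu, Algebra.algebraMap_eq_smul_one, sub_apply, hFv]; simp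
  have h1 : (v : X) = ((↑u⁻¹ : X →L[ℂ] X) * ↑u) v := by rw [Units.inv_mul]; rfl
  apply hv.2
  ext
  rw [h1, mul_apply_eq_comp, h0, map_zero, ZeroMemClass.coe_zero]

omit [CompleteSpace X] in
/-- The regularized determinant is multiplicative on sums of mutually annihilating operators. -/
lemma detp_add_of_mul_eq_zero (p : ℝ) (V : Submodule ℂ X) [FiniteDimensional ℂ V]
    {E F : X →L[ℂ] X} (hE : ∀ x, E x ∈ V) (hF : ∀ x, F x ∈ V) (hEF : E * F = 0) (hFE : F * E = 0) :
    detp p (E + F) = detp p E * detp p F := by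
  have hadd : ∀ x, (E + F) x ∈ V := fun x => V.add_mem (hE x) (hF x)
  rw [detp_eq p V _ hadd, detp_eq p V E hE, detp_eq p V F hF, restrictTo_add V E F hE hF]
  set a := restrictTo V E hE
  set b := restrictTo V F hF
  have hab : a * b = 0 := by
    ext v
    exact DFunLike.congr_fun hEF (v : X)
  have hba : b * a = 0 := by
    ext v
    exact DFunLike.congr_fun hFE (v : X)
  have hpow : ∀ k : ℕ, (a + b) ^ (k + 1) = a ^ (k + 1) + b ^ (k + 1) := by
    intro k
    induction k with
    | zero => simp
    | succ k ih =>
      rw [pow_succ, ih, add_mul, mul_add, mul_add, pow_succ a k, pow_succ b k, mul_assoc _ a b,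
        mul_assoc _ b a, hab, hba, pow_succ a (k + 1), pow_succ b (k + 1), pow_succ a k, pow_succ b k]
      simp
  have hdet : 1 - (a + b) = (1 - a) * (1 - b) := by
    rw [sub_mul, mul_sub, mul_sub, hab]; simp; abel
  have htr : ∑ k ∈ Finset.Icc 1 (⌈p⌉₊ - 1), LinearMap.trace ℂ V ((a + b) ^ k) / (k : ℂ) =
      ∑ k ∈ Finset.Icc 1 (⌈p⌉₊ - 1), LinearMap.trace ℂ V (a ^ k) / (k : ℂ) +
      ∑ k ∈ Finset.Icc 1 (⌈p⌉₊ - 1), LinearMap.trace ℂ V (b ^ k) / (k : ℂ) := by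
    rw [← Finset.sum_add_distrib]
    refine Finset.sum_congr rfl fun k hk => ?_
    obtain ⟨j, rfl⟩ := Nat.exists_eq_add_of_le' (Finset.mem_Icc.1 hk).1
    rw [hpow, map_add, add_div]
  rw [hdet, htr, map_mul, Complex.exp_add]
  ring

omit [CompleteSpace X] in
/-- Comparison of the regularized determinant of `E + F` with that of `E`, when `F` carries the
small eigenvalues. -/
lemma norm_detp_add_le (p : ℝ) {E F : X →L[ℂ] X} (hE : IsFiniteRank E) (hF : IsFiniteRank F)
    (hEF : E * F = 0) (hFE : F * E = 0) {r M : ℝ} (hr : 0 < r) (hr' : r ≤ 1 / 8) (hM : 0 < M)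
    (hEs : ∀ l ∈ spectrum ℂ E, l = 0 ∨ r ≤ ‖l‖) (hFs : ∀ l ∈ spectrum ℂ F, ‖l‖ < 2 * r)
    (hbd : ∀ z : ℂ, ‖z‖ = 2 / r → ‖detp p (z • (E + F))‖ ≤ Real.exp M) :
    ‖detp p (E + F)‖ ≤ ‖detp p E‖ * Real.exp (4 * M * (4 * r) ^ (⌈p⌉₊ - 1 + 1)) := by
  classical
  let V : Submodule ℂ X := LinearMap.range (E : X →ₗ[ℂ] X) ⊔ LinearMap.range (F : X →ₗ[ℂ] X)
  have : FiniteDimensional ℂ (LinearMap.range (E : X →ₗ[ℂ] X)) := hE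
  have : FiniteDimensional ℂ (LinearMap.range (F : X →ₗ[ℂ] X)) := hF
  have hEV : ∀ x, E x ∈ V := fun x => Submodule.mem_sup_left (LinearMap.mem_range_self _ x)
  have hFV : ∀ x, F x ∈ V := fun x => Submodule.mem_sup_right (LinearMap.mem_range_self _ x)
  have hw0 : ∀ m, weierstrassFactor m 0 = 1 := by
    intro m
    rw [weierstrassFactor, Finset.sum_eq_zero, Complex.exp_zero, sub_zero, one_mul]
    intro k hk
    rw [zero_pow (by have := (Finset.mem_Icc.1 hk).1; omega), zero_div]
  set S := (restrictTo V F hFV).charpoly.roots with hS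
  set B := (restrictTo V E hEV).charpoly.roots with hB
  have hfilter : ∀ z : ℂ, (B.map fun l => weierstrassFactor (⌈p⌉₊ - 1) (z * l)).prod =
      ((B.filter (· ≠ 0)).map fun l => weierstrassFactor (⌈p⌉₊ - 1) (z * l)).prod := by
    intro z
    conv_lhs => rw [← Multiset.filter_add_not (· ≠ 0) B]
    rw [Multiset.map_add, Multiset.prod_add]
    convert mul_one _
    refine Multiset.prod_eq_one fun y hy => ?_
    obtain ⟨l, hl, rfl⟩ := Multiset.mem_map.1 hy
    have : l = 0 := by simpa using (Multiset.mem_filter.1 hl).2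
    rw [this, mul_zero, hw0]
  rw [detp_add_of_mul_eq_zero p V hEV hFV hEF hFE, norm_mul]
  refine mul_le_mul_of_nonneg_left ?_ (norm_nonneg _)
  have hFeq : detp p F = (S.map fun l => weierstrassFactor (⌈p⌉₊ - 1) l).prod := by
    have := detp_smul_eq_prod p V F hFV 1
    simpa using this
  rw [hFeq]
  refine norm_prod_weierstrassFactor_le (⌈p⌉₊ - 1) (B := B.filter (· ≠ 0)) hr hr' hM ?_ ?_ ?_
  · intro l hl
    obtain ⟨hl, hl0⟩ := Multiset.mem_filter.1 hl
    exact (hEs l (mem_spectrum_of_mem_roots V hEV hl)).resolve_left hl0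
  · exact fun l hl => hFs l (mem_spectrum_of_mem_roots V hFV hl)
  · intro z hz
    rw [Multiset.map_add, Multiset.prod_add, ← hfilter, hB, hS, ← detp_smul_eq_prod,
      ← detp_smul_eq_prod, ← detp_add_of_mul_eq_zero p V (fun x => V.smul_mem z (hEV x))
        (fun x => V.smul_mem z (hFV x)), ← smul_add]
    · exact hbd z hz
    · rw [smul_mul_smul_comm, hEF, smul_zero]
    · rw [smul_mul_smul_comm, hFE, smul_zero]

variable {T : X →L[ℂ] X} {r : ℝ}

lemma norm_le_of_mem_spectrum_rieszProjection_mul (hr : 0 < r)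
    (h : Metric.sphere 0 r ⊆ resolventSet ℂ T) {w : ℂ}
    (hw : w ∈ spectrum ℂ (rieszProjection T 0 r * T)) : ‖w‖ ≤ r := by
  by_contra hlt
  have hw' : w ∉ Metric.closedBall (0 : ℂ) r := by simpa using hlt
  have hw0 : w ≠ 0 := by rintro rfl; simp [hr.le] at hw'
  have hQQ := rieszProjection_mul_self hr h
  obtain ⟨h1, h2⟩ := rieszCauchy_of_notMem_closedBall hr h hw'
  exact hw (resolvent_block hQQ (commute_rieszProjection hr.le h (Commute.refl T)).symm hw0
    (by rw [h1, hQQ, hQQ]) (by rw [h2, hQQ, hQQ])).1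

lemma eq_zero_or_le_norm_of_mem_spectrum_one_sub_rieszProjection_mul (hr : 0 < r)
    (h : Metric.sphere 0 r ⊆ resolventSet ℂ T) {w : ℂ}
    (hw : w ∈ spectrum ℂ ((1 - rieszProjection T 0 r) * T)) : w = 0 ∨ r ≤ ‖w‖ := by
  by_contra! hcon
  obtain ⟨hw0, hlt⟩ := hcon
  have hw' : w ∈ Metric.ball (0 : ℂ) r := by simpa using hlt
  have hQQ := rieszProjection_mul_self hr h
  have hPP : (1 - rieszProjection T 0 r) * (1 - rieszProjection T 0 r) =
      1 - rieszProjection T 0 r := (IsIdempotentElem.one_sub hQQ)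
  obtain ⟨h1, h2⟩ := rieszCauchy_of_mem_ball hr h hw'
  have hPT : Commute (1 - rieszProjection T 0 r) T :=
    ((Commute.one_right T).sub_right
      (commute_rieszProjection hr.le h (Commute.refl T))).symm
  have e : ∀ S : X →L[ℂ] X, S = rieszProjection T 0 r - 1 →
      (1 - rieszProjection T 0 r) * -S * (1 - rieszProjection T 0 r) =
        1 - rieszProjection T 0 r := by
    rintro S rfl
    rw [neg_sub, hPP, hPP]
  refine hw (resolvent_block (B := -rieszCauchy T 0 r w) hPP hPT hw0 ?_ ?_).1
  · rw [mul_neg]; exact e _ h1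
  · rw [neg_mul]; exact e _ h2

lemma exists_sphere_subset_resolventSet
    (hT : ∀ ε > 0, ∃ F : X →L[ℂ] X, IsFiniteRank F ∧ ‖T - F‖ < ε) {R : ℝ} (hR : 0 < R) :
    ∃ r, 0 < r ∧ r ≤ R ∧ Metric.sphere 0 r ⊆ resolventSet ℂ T := by
  have hfin := (finite_spectrum_of_approx hT (half_pos hR)).image norm
  obtain ⟨r, hr, hrn⟩ := (Set.Ioo_infinite (half_lt_self hR)).exists_notMem_finite hfin
  refine ⟨r, (half_pos hR).trans hr.1, hr.2.le, fun z hz => ?_⟩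
  rw [mem_sphere_zero_iff_norm] at hz
  by_contra hz'
  exact hrn ⟨z, ⟨hz', by rw [hz]; exact hr.1.le⟩, hz⟩

end Splitting

namespace LpIdeal

variable {p : ℝ} (I : LpIdeal p X)

lemma exists_isFiniteRank_norm_sub_lt {L : X →L[ℂ] X} (hL : L ∈ I.carrier) :
    ∀ ε > 0, ∃ F : X →L[ℂ] X, IsFiniteRank F ∧ ‖L - F‖ < ε := by
  intro ε hε
  obtain ⟨F, hF, hFL⟩ := I.dense_finiteRank L hL ε hε
  exact ⟨F, hF, (I.opNorm_le _ (I.sub_mem hL (I.finiteRank_mem F hF))).trans_lt hFL⟩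

lemma isCompactOperator {L : X →L[ℂ] X} (hL : L ∈ I.carrier) : IsCompactOperator L := by
  have hcl : L ∈ closure {T : X →L[ℂ] X | IsCompactOperator T} := by
    refine Metric.mem_closure_iff.2 fun ε hε => ?_
    obtain ⟨F, hF, hFL⟩ := I.exists_isFiniteRank_norm_sub_lt hL ε hε
    exact ⟨F, hF.isCompactOperator, by rwa [dist_eq_norm]⟩
  rwa [isClosed_setOfPred_isCompactOperator.closure_eq] at hcl

/-- A continuous extension of the regularized determinant obeys the eigenvalue bound with the
eigenvalues of the operator itself, up to a factor arbitrarily close to one. -/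
lemma norm_extension_le_mul (hp : 0 < p) {Γ : ℝ} (hΓ : 0 < Γ)
    (hΓb : ∀ F : X →L[ℂ] X, IsFiniteRank F → ‖detp p F‖ ≤ Real.exp (Γ * (eigSum p F).toReal))
    {D : (X →L[ℂ] X) → ℂ} (hDc : IdealContinuous I D) (hDe : ExtendsDetp p D)
    {L : X →L[ℂ] X} (hL : L ∈ I.carrier) {δ : ℝ} (hδ : 0 < δ) :
    ‖D L‖ ≤ Real.exp (Γ * (eigSum p L).toReal) *
      Real.exp (4 * 2 ^ p * 4 ^ (⌈p⌉₊ - 1 + 1) * δ) := by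
  have hT := I.exists_isFiniteRank_norm_sub_lt hL
  have hLc := I.isCompactOperator hL
  obtain ⟨η, hη, R, hR, hgrow⟩ := I.exists_norm_detp_smul_le hp hΓ hΓb hL hδ
  obtain ⟨r, hr, hrR, hsph⟩ := exists_sphere_subset_resolventSet hT
    (R := min (1 / 8) (2 / R)) (by positivity)
  have hr8 : r ≤ 1 / 8 := hrR.trans (min_le_left _ _)
  have hRr : R ≤ 2 / r := by
    rw [le_div_iff₀ hr, mul_comm, ← le_div_iff₀ hR]; exact hrR.trans (min_le_right _ _)
  have hFs' := fun w => norm_le_of_mem_spectrum_rieszProjection_mul hr hsph (w := w)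
  have hEs := fun w =>
    eq_zero_or_le_norm_of_mem_spectrum_one_sub_rieszProjection_mul hr hsph (w := w)
  have hQQ := rieszProjection_mul_self hr hsph
  have hQL : Commute (rieszProjection L 0 r) L :=
    (commute_rieszProjection hr.le hsph (Commute.refl L)).symm
  have hPfin := isFiniteRank_one_sub_rieszProjection hLc hr hsph (Metric.mem_ball_self hr)
  set Q := rieszProjection L 0 r with hQ
  have hPP : (1 - Q) * (1 - Q) = 1 - Q := IsIdempotentElem.one_sub hQQ
  have hPL : Commute (1 - Q) L := (Commute.one_left L).sub_left hQL
  set E := (1 - Q) * L with hE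
  have hEfin : IsFiniteRank E := hPfin.mul_right L
  have hEle : ‖detp p E‖ ≤ Real.exp (Γ * (eigSum p L).toReal) := by
    refine (hΓb E hEfin).trans (Real.exp_le_exp.2 ?_)
    gcongr
    · exact ((I.eig_le L hL).trans_lt ENNReal.ofReal_lt_top).ne
    · exact eigSum_block_le hp hPP hPL hT hLc
  refine le_of_forall_pos_le_add fun ε hε => ?_
  obtain ⟨η', hη', hD⟩ := hDc L hL ε hε
  have husc : UpperHemicontinuousAt (spectrum ℂ) (Q * L) :=
    upperHemicontinuous_spectrum ℂ (X →L[ℂ] X) _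
  have hev := husc.forall_isOpen (Metric.ball 0 (2 * r)) Metric.isOpen_ball fun w hw => by
    rw [mem_ball_zero_iff]; linarith [hFs' w hw]
  obtain ⟨ε', hε', hspec⟩ := Metric.eventually_nhds_iff.1 hev
  set κ := min (min η η') ε' with hκ
  have hκ0 : 0 < κ := by positivity
  obtain ⟨G, hG, hGL⟩ := I.dense_finiteRank L hL (κ / (‖Q‖ * ‖Q‖ + 1)) (by positivity)
  have hGI := I.finiteRank_mem G hG
  set F := Q * G * Q with hF
  have hFfin : IsFiniteRank F := (hG.mul_left Q).mul_right Q
  have hQLQ : Q * L * Q = Q * L := by rw [mul_assoc, ← hQL.eq, ← mul_assoc, hQQ]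
  have hdiff : E + F - L = Q * (G - L) * Q := by
    rw [mul_sub, sub_mul, hQLQ, hE, hF, sub_mul, one_mul]; abel
  have hdiff' : F - Q * L = Q * (G - L) * Q := by
    rw [mul_sub, sub_mul, hQLQ]
  have hsmall : I.norm' (Q * (G - L) * Q) < κ := by
    refine (I.mul_norm'_le _ (I.sub_mem hGI hL) Q Q).trans_lt ?_
    rw [lt_div_iff₀ (by positivity)] at hGL
    rw [I.norm'_sub_comm hGI hL]
    have h0 := I.norm'_nonneg _ (I.sub_mem hL hGI)
    linarith
  have hEFI : E + F ∈ I.carrier := I.finiteRank_mem _ (hEfin.add hFfin)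
  have hPQ : (1 - Q) * Q = 0 := by rw [sub_mul, one_mul, hQQ, sub_self]
  have hQP : Q * (1 - Q) = 0 := by rw [mul_sub, mul_one, hQQ, sub_self]
  have hEF : E * F = 0 := by
    rw [hE, hPL.eq, hF, mul_assoc L, mul_assoc Q G, ← mul_assoc (1 - Q), hPQ, zero_mul, mul_zero]
  have hFE : F * E = 0 := by
    rw [hE, hF, ← mul_assoc, mul_assoc _ Q, hQP, mul_zero, zero_mul]
  have hFs : ∀ l ∈ spectrum ℂ F, ‖l‖ < 2 * r := fun l hl => by
    have hd : dist F (Q * L) < ε' := by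
      rw [dist_eq_norm, hdiff']
      exact (I.opNorm_le _ (I.mul_mem _ (I.sub_mem hGI hL) Q Q)).trans_lt
        (hsmall.trans_le (min_le_right _ _))
    simpa using hspec hd hl
  have hnear : I.norm' (E + F - L) < min η η' := by
    rw [hdiff]; exact hsmall.trans_le (min_le_left _ _)
  have hmain := norm_detp_add_le p hEfin hFfin hEF hFE hr hr8 (M := δ * (2 / r) ^ p)
    (by positivity) hEs hFs fun z hz => by
      have := hgrow (E + F) (hEfin.add hFfin) (hnear.trans_le (min_le_left _ _)) z (hz ▸ hRr)
      rwa [hz] at this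
  have hexp : 4 * (δ * (2 / r) ^ p) * (4 * r) ^ (⌈p⌉₊ - 1 + 1) ≤
      4 * 2 ^ p * 4 ^ (⌈p⌉₊ - 1 + 1) * δ := by
    have h1 : 1 ≤ ⌈p⌉₊ := Nat.one_le_iff_ne_zero.2 (Nat.ceil_pos.2 hp).ne'
    have h2 : r ^ (⌈p⌉₊ - 1 + 1) ≤ r ^ p := by
      rw [← Real.rpow_natCast, Nat.sub_add_cancel h1]
      exact Real.rpow_le_rpow_of_exponent_ge hr (by linarith) (Nat.le_ceil p)
    have hrp : 0 < r ^ p := Real.rpow_pos_of_pos hr p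
    rw [Real.div_rpow (by norm_num) hr.le, mul_pow]
    calc 4 * (δ * (2 ^ p / r ^ p)) * (4 ^ (⌈p⌉₊ - 1 + 1) * r ^ (⌈p⌉₊ - 1 + 1))
        ≤ 4 * (δ * (2 ^ p / r ^ p)) * (4 ^ (⌈p⌉₊ - 1 + 1) * r ^ p) := by gcongr
      _ = _ := by field_simp
  have hDEF := hD (E + F) hEFI (hnear.trans_le (min_le_right _ _))
  rw [hDe _ (hEfin.add hFfin)] at hDEF
  calc ‖D L‖ = ‖detp p (E + F) - (detp p (E + F) - D L)‖ := by rw [sub_sub_cancel]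
    _ ≤ ‖detp p (E + F)‖ + ‖detp p (E + F) - D L‖ := norm_sub_le _ _
    _ ≤ _ := by
      refine add_le_add (hmain.trans ?_) hDEF.le
      gcongr

/-- A continuous extension of the regularized determinant obeys the eigenvalue bound. -/
lemma norm_extension_le (hp : 0 < p) {Γ : ℝ} (hΓ : 0 < Γ)
    (hΓb : ∀ F : X →L[ℂ] X, IsFiniteRank F → ‖detp p F‖ ≤ Real.exp (Γ * (eigSum p F).toReal))
    {D : (X →L[ℂ] X) → ℂ} (hDc : IdealContinuous I D) (hDe : ExtendsDetp p D)
    {L : X →L[ℂ] X} (hL : L ∈ I.carrier) :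
    ‖D L‖ ≤ Real.exp (I.γ ^ p * Γ * I.norm' L ^ p) := by
  have hlim : Filter.Tendsto (fun δ : ℝ => Real.exp (Γ * (eigSum p L).toReal) *
      Real.exp (4 * 2 ^ p * 4 ^ (⌈p⌉₊ - 1 + 1) * δ)) (nhdsWithin 0 (Set.Ioi 0))
      (nhds (Real.exp (Γ * (eigSum p L).toReal))) := by
    have hcont : Continuous (fun δ : ℝ => Real.exp (Γ * (eigSum p L).toReal) *
      Real.exp (4 * 2 ^ p * 4 ^ (⌈p⌉₊ - 1 + 1) * δ)) := by fun_prop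
    have := (hcont.tendsto 0).mono_left (nhdsWithin_le_nhds (s := Set.Ioi 0))
    simpa using this
  refine (ge_of_tendsto hlim (Filter.eventually_of_mem self_mem_nhdsWithin fun δ hδ =>
    I.norm_extension_le_mul hp hΓ hΓb hDc hDe hL hδ)).trans (Real.exp_le_exp.2 ?_)
  have h0 := I.norm'_nonneg L hL
  rw [mul_comm (I.γ ^ p), mul_assoc, ← Real.mul_rpow I.γ_nonneg h0]
  gcongr
  exact ENNReal.toReal_le_of_le_ofReal
    (Real.rpow_nonneg (mul_nonneg I.γ_nonneg h0) _) (I.eig_le L hL)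

lemma mul_right_mem {L : X →L[ℂ] X} (hL : L ∈ I.carrier) (B : X →L[ℂ] X) :
    L * B ∈ I.carrier := by
  simpa using I.mul_mem L hL 1 B

lemma norm'_mul_right_le {L : X →L[ℂ] X} (hL : L ∈ I.carrier) (B : X →L[ℂ] X) :
    I.norm' (L * B) ≤ I.norm' L * ‖B‖ := by
  have h := I.mul_norm'_le L hL 1 B
  rw [one_mul] at h
  have h1 : ‖(1 : X →L[ℂ] X)‖ ≤ 1 := ContinuousLinearMap.norm_id_le
  have := mul_le_mul_of_nonneg_right
    (mul_le_mul_of_nonneg_right h1 (I.norm'_nonneg L hL)) (norm_nonneg B)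
  rw [one_mul] at this
  exact h.trans this

variable {D : (X →L[ℂ] X) → ℂ}

lemma tendsto_extension_mul_resolvent (hDc : IdealContinuous I D) (hDe : ExtendsDetp p D)
    (A : X →L[ℂ] X) {K : X →L[ℂ] X} (hK : K ∈ I.carrier) :
    Filter.Tendsto (fun z : ℂ => D (K * resolvent A z)) (Bornology.cobounded ℂ) (nhds 1) := by
  have h0fin : IsFiniteRank (0 : X →L[ℂ] X) := isFiniteRank_zero
  have hD0 : D 0 = 1 := (hDe 0 h0fin).trans (detp_zero p)
  have hlim : Filter.Tendsto (fun z : ℂ => I.norm' K * ‖resolvent A z‖)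
      (Bornology.cobounded ℂ) (nhds 0) := by
    have := ((spectrum.resolvent_tendsto_cobounded (𝕜 := ℂ) A).norm).const_mul (I.norm' K)
    simpa using this
  rw [Metric.tendsto_nhds]
  intro ε hε
  obtain ⟨δ, hδ, hD⟩ := hDc 0 (I.finiteRank_mem 0 h0fin) ε hε
  filter_upwards [hlim.eventually (gt_mem_nhds hδ)] with z hz
  have := hD (K * resolvent A z) (I.mul_right_mem hK _) (by
    rw [sub_zero]; exact (I.norm'_mul_right_le hK _).trans_lt hz)
  rwa [hD0, ← dist_eq_norm] at this

lemma differentiableOn_extension_mul (hDc : IdealContinuous I D) (hDe : ExtendsDetp p D)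
    {K : X →L[ℂ] X} (hK : K ∈ I.carrier) {S : ℂ → X →L[ℂ] X} {U : Set ℂ} (hU : IsOpen U)
    (hS : DifferentiableOn ℂ S U) : DifferentiableOn ℂ (fun z => D (K * S z)) U := by
  have hq : 0 < I.q := zero_lt_one.trans_le I.one_le_q
  choose F hF hFK using fun n : ℕ => I.dense_finiteRank K hK (1 / (n + 1 : ℝ)) (by positivity)
  have hFI := fun n => I.finiteRank_mem _ (hF n)
  have hlim : Filter.Tendsto (fun n => I.norm' (F n - K)) Filter.atTop (nhds 0) :=
    squeeze_zero (fun n => I.norm'_nonneg _ (I.sub_mem (hFI n) hK))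
      (fun n => by rw [I.norm'_sub_comm (hFI n) hK]; exact (hFK n).le)
      tendsto_one_div_add_atTop_nhds_zero_nat
  have hdiff : ∀ n, DifferentiableOn ℂ (fun z => D (F n * S z)) U := by
    intro n
    have : FiniteDimensional ℂ (LinearMap.range (F n : X →ₗ[ℂ] X)) := hF n
    refine (differentiableOn_detp_mul p _ (F n) (fun x => LinearMap.mem_range_self _ x) hS).congr
      fun z _ => hDe _ ((hF n).mul_right (S z))
  have hloc : TendstoLocallyUniformlyOn (fun n z => D (F n * S z)) (fun z => D (K * S z))
      Filter.atTop U := by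
    rw [Metric.tendstoLocallyUniformlyOn_iff]
    intro ε hε z₀ hz₀
    have hL := I.mul_right_mem hK (S z₀)
    obtain ⟨δ, hδ, hD⟩ := hDc _ hL (ε / 2) (half_pos hε)
    have hSc : ContinuousWithinAt S U z₀ := hS.continuousOn z₀ hz₀
    have hz1 : ∀ᶠ z in nhdsWithin z₀ U, I.norm' K * ‖S z - S z₀‖ < δ / (2 * I.q) := by
      have h1 : Filter.Tendsto (fun z => I.norm' K * ‖S z - S z₀‖) (nhdsWithin z₀ U) (nhds 0) := by
        have := ((hSc.tendsto.sub_const (S z₀)).norm).const_mul (I.norm' K)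
        simpa using this
      exact h1.eventually (gt_mem_nhds (by positivity))
    have hz2 : ∀ᶠ z in nhdsWithin z₀ U, ‖S z‖ < ‖S z₀‖ + 1 :=
      hSc.tendsto.norm.eventually (gt_mem_nhds (lt_add_one _))
    have hn : ∀ᶠ n in Filter.atTop, I.norm' (F n - K) < δ / (2 * I.q) / (‖S z₀‖ + 1) :=
      hlim.eventually (gt_mem_nhds (by positivity))
    refine ⟨_, hz1.and hz2, hn.mono fun n hn z hz => ?_⟩
    obtain ⟨hz1, hz2⟩ := hz
    have hFKI := I.sub_mem (hFI n) hK
    have hb1 : I.norm' (K * (S z - S z₀)) < δ / (2 * I.q) :=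
      (I.norm'_mul_right_le hK _).trans_lt hz1
    have hb2 : I.norm' ((F n - K) * S z) < δ / (2 * I.q) := by
      refine (I.norm'_mul_right_le hFKI _).trans_lt ?_
      rw [lt_div_iff₀ (by positivity)] at hn
      exact (mul_le_mul_of_nonneg_left hz2.le (I.norm'_nonneg _ hFKI)).trans_lt hn
    have hδ2 : I.q * (δ / (2 * I.q) + δ / (2 * I.q)) = δ := by field_simp; ring
    have hpos : 0 < δ / (2 * I.q) := by positivity
    have hD1 : ‖D (K * S z) - D (K * S z₀)‖ < ε / 2 := by
      refine hD _ (I.mul_right_mem hK _) ?_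
      rw [← mul_sub]
      refine hb1.trans_le ?_
      rw [div_le_iff₀ (by positivity)]
      have := I.one_le_q
      nlinarith
    have hD2 : ‖D (F n * S z) - D (K * S z₀)‖ < ε / 2 := by
      refine hD _ (I.mul_right_mem (hFI n) _) ?_
      have e : F n * S z - K * S z₀ = (F n - K) * S z + K * (S z - S z₀) := by
        rw [sub_mul, mul_sub]; abel
      rw [e]
      refine (I.norm'_add_le _ (I.mul_right_mem hFKI _) _ (I.mul_right_mem hK _)).trans_lt ?_
      rw [← hδ2]
      gcongr
    rw [dist_eq_norm, ← sub_sub_sub_cancel_right _ _ (D (K * S z₀))]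
    exact (norm_sub_le _ _).trans_lt (by linarith)
  exact hloc.differentiableOn (Filter.Eventually.of_forall hdiff) hU

end LpIdeal

/-- Let `I` be an `l_p`-ideal in `B(X)` with eigenvalue constant `γ`, let
`Γ > 0` satisfy the determinant bound for finite rank operators, let `A ∈ B(X)`, `K ∈ I`,
and let `D(z) = det_{p,I}(I - K (z-A)⁻¹)` be the perturbation determinant.  Then
(i) `D(z) → 1` as `|z| → ∞`; (ii) `D` is analytic on `ρ(A)`; and
(iii) `|D(z)| ≤ exp(γ^p Γ ‖K (z-A)⁻¹‖_I^p)` for `z ∈ ρ(A)`. -/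
theorem perturbationDeterminant_properties (p : ℝ) (hp : 0 < p) (I : LpIdeal p X)
    (Γ : ℝ) (hΓ : 0 < Γ)
    (hΓb : ∀ F : X →L[ℂ] X, IsFiniteRank F →
      ‖detp p F‖ ≤ Real.exp (Γ * (eigSum p F).toReal))
    (D : (X →L[ℂ] X) → ℂ) (hDc : IdealContinuous I D) (hDe : ExtendsDetp p D)
    (A K : X →L[ℂ] X) (hK : K ∈ I.carrier) :
    Filter.Tendsto (fun z : ℂ => D (K * resolvent A z)) (Bornology.cobounded ℂ) (nhds 1) ∧
    AnalyticOnNhd ℂ (fun z : ℂ => D (K * resolvent A z)) (resolventSet ℂ A) ∧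
    ∀ z ∈ resolventSet ℂ A,
      ‖D (K * resolvent A z)‖ ≤
        Real.exp (I.γ ^ p * Γ * I.norm' (K * resolvent A z) ^ p) := by
  have hopen : IsOpen (resolventSet ℂ A) := spectrum.isOpen_resolventSet A
  exact ⟨I.tendsto_extension_mul_resolvent hDc hDe A hK,
    (I.differentiableOn_extension_mul hDc hDe hK hopen
      (differentiableOn_resolvent A)).analyticOnNhd hopen,
    fun z _ => I.norm_extension_le hp hΓ hΓb hDc hDe (I.mul_right_mem hK _)⟩
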